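/- Let (f_w) denote the sequence of normalized extremal quasimodular forms of depth 3 and even weight w ≥ 6. Define K^up_w f = 48(7w^2+42w+60)∂_{w−3}^3 f − (15w^4+96w^3+151w^2−30w−116) E_4 ∂_{w−3} f − (1/6)(w+1)(9w^4+45w^3+40w^2+24w+144) E_6 f. Then for w ≡ 0 (mod 6): f_6 = (5E_2^3 − 3E_2E_4 − 2E_6)/51840, and f_{w+6} = ((w+6)^3/(2^2·3^7·(w+1)(w+2)^3(w+4)^3(w+5))) · K^up_w f_w. Furthermore f_{w+2} = (4/(w+1)) ∂_{w−3} f_w and f_{w+4} = (2(w+3)^2/(27(w+1)(w+2)^3)) · (((w+1)(3w+1)/48) E_4 f_w − ∂_{w−3}^2 f_w). -/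

import Mathlib

open Complex UpperHalfPlane Finset
open scoped Manifold MatrixGroups Real

noncomputable section

/-- The nome `q = e^{2πiz}`. -/
def qexp (z : ℍ) : ℂ := Complex.exp (2 * Real.pi * Complex.I * z)

/-- The normalized Eisenstein series `E_k` (for even `k ≥ 2`), defined via its
`q`-expansion `E_k = 1 - (2k/B_k) ∑_{n ≥ 1} σ_{k-1}(n) q^n`. -/
def Eis (k : ℕ) (z : ℍ) : ℂ :=
  1 - (2 * k / ((bernoulli k : ℚ) : ℂ)) *
    ∑' n : ℕ, (ArithmeticFunction.sigma (k - 1) (n + 1) : ℂ) * qexp z ^ (n + 1)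

/-- The modular discriminant `Δ = (E_4³ − E_6²)/1728`. -/
def Disc (z : ℍ) : ℂ := (Eis 4 z ^ 3 - Eis 6 z ^ 2) / 1728

/-- The space of holomorphic modular forms of weight `w` for the full modular group,
as a set of functions on `ℍ`. -/
def Mset (w : ℤ) : Set (ℍ → ℂ) :=
  {f | ∃ F : ModularForm (⊤ : Subgroup SL(2, ℤ)) w, ⇑F = f}

/-- The set of quasimodular forms of weight `w` and depth `≤ r`:
functions of the form `∑_{ℓ=0}^r E_2^ℓ h_ℓ` with `h_ℓ ∈ M_{w-2ℓ}`. -/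
def QMset (w : ℤ) (r : ℕ) : Set (ℍ → ℂ) :=
  {f | ∃ h : ℕ → ℍ → ℂ, (∀ ℓ ≤ r, h ℓ ∈ Mset (w - 2 * ℓ)) ∧
        ∀ z, f z = ∑ ℓ ∈ Finset.range (r + 1), Eis 2 z ^ ℓ * h ℓ z}

/-- `QM_w^r` as a `ℂ`-subspace of the functions on `ℍ`. -/
def QM (w : ℤ) (r : ℕ) : Submodule ℂ (ℍ → ℂ) := Submodule.span ℂ (QMset w r)

/-- `dim QM_w^r`. -/
def dimQM (w : ℤ) (r : ℕ) : ℕ := Module.finrank ℂ (QM w r)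

/-- The complex derivative of a function on `ℍ` (via an extension to `ℂ`; since `ℍ` is
open in `ℂ` this agrees with the complex derivative for holomorphic `f`). -/
def hderiv (f : ℍ → ℂ) (z : ℍ) : ℂ :=
  deriv (fun w : ℂ => if h : 0 < w.im then f ⟨w, h⟩ else 0) z

/-- The normalized derivative `f' = (2πi)⁻¹ df/dz = q df/dq`. -/
def qderiv (f : ℍ → ℂ) (z : ℍ) : ℂ := (2 * Real.pi * Complex.I)⁻¹ * hderiv f z

/-- The Serre derivative `∂_w f = f' - (w/12) E_2 f`. -/
def serre (w : ℤ) (f : ℍ → ℂ) (z : ℍ) : ℂ :=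
  qderiv f z - ((w : ℂ) / 12) * Eis 2 z * f z

/-- Iterated Serre derivatives: `∂_w^0 f = f`, `∂_w^{k+1} f = ∂_{w+2k}(∂_w^k f)`. -/
def serreIter (w : ℤ) : ℕ → (ℍ → ℂ) → (ℍ → ℂ)
  | 0, f => f
  | (k + 1), f => serre (w + 2 * k) (serreIter w k f)

/-- `z ↦ -1/z` as a map `ℍ → ℍ`. -/
def Sact (z : ℍ) : ℍ :=
  ⟨-(z : ℂ)⁻¹, by
    have h0 : (z : ℂ) ≠ 0 := z.ne_zero
    have : (-(z : ℂ)⁻¹).im = (z : ℂ).im / Complex.normSq (z : ℂ) := by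
      rw [Complex.neg_im, Complex.inv_im]; ring
    rw [this]
    exact div_pos z.im_pos (Complex.normSq_pos.mpr h0)⟩

/-- `z ↦ z + 1` as a map `ℍ → ℍ`. -/
def Tact (z : ℍ) : ℍ := ⟨(z : ℂ) + 1, by simpa using z.im_pos⟩

/-- `g` has a `q`-expansion with vanishing order exactly `ν` at `i∞`:
`g = q^ν ∑_{n≥0} a(n) qⁿ` with `a(0) ≠ 0`. -/
def HasQExpansionAt (g : ℍ → ℂ) (ν : ℕ) : Prop :=
  ∃ a : ℕ → ℂ, a 0 ≠ 0 ∧ ∀ z : ℍ, HasSum (fun n : ℕ => a n * qexp z ^ (ν + n)) (g z)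

/-- The quasimodular forms `g_ℓ` attached to `f = ∑_{ℓ=0}^r E_2^ℓ h_ℓ`, defined by
`C(r,ℓ) g_ℓ = (6/(πi))^ℓ ∑_{m=0}^{r-ℓ} C(ℓ+m,m) E_2^m h_{ℓ+m}`. -/
def gOf (r : ℕ) (h : ℕ → ℍ → ℂ) (ℓ : ℕ) (z : ℍ) : ℂ :=
  ((r.choose ℓ : ℂ))⁻¹ * (6 / ((Real.pi : ℂ) * Complex.I)) ^ ℓ *
    ∑ m ∈ Finset.range (r - ℓ + 1), (((ℓ + m).choose m : ℕ) : ℂ) * Eis 2 z ^ m * h (ℓ + m) z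

/-- `f` is a balanced quasimodular form of weight `w` and depth `r`. -/
def IsBalancedQM (w : ℤ) (r : ℕ) (f : ℍ → ℂ) : Prop :=
  ∃ h : ℕ → ℍ → ℂ, ∃ lam : ℕ → ℕ,
    (∀ ℓ ≤ r, h ℓ ∈ Mset (w - 2 * ℓ)) ∧ h r ≠ 0 ∧
    (∀ z, f z = ∑ ℓ ∈ Finset.range (r + 1), Eis 2 z ^ ℓ * h ℓ z) ∧
    (∀ ℓ ≤ r, HasQExpansionAt (gOf r h ℓ) (lam ℓ)) ∧
    (∀ i j, i ≤ j → j ≤ r → lam j ≤ lam i) ∧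
    (∀ ℓ ≤ r, lam ℓ < dimQM (w - 2 * ℓ) (r - ℓ)) ∧
    (∑ ℓ ∈ Finset.range (r + 1), lam ℓ) = dimQM w r - 1

/-- `f` is the normalized extremal quasimodular form of weight `w` and depth `r`:
`f ∈ QM_w^r` with `q`-expansion `q^{dim QM_w^r - 1}(1 + O(q))`. -/
def IsNormalizedExtremalQM (w : ℤ) (r : ℕ) (f : ℍ → ℂ) : Prop :=
  f ∈ QM w r ∧ ∃ a : ℕ → ℂ, a 0 = 1 ∧
    ∀ z : ℍ, HasSum (fun n : ℕ => a n * qexp z ^ (dimQM w r - 1 + n)) (f z)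

/-- `f 0, …, f (n-1)` is a fundamental system of solutions of the linear differential
equation `K g = 0`: holomorphic linearly independent solutions spanning all
holomorphic solutions. -/
def IsFundamentalSystem {n : ℕ} (K : (ℍ → ℂ) → (ℍ → ℂ)) (f : Fin n → ℍ → ℂ) : Prop :=
  (∀ i, MDifferentiable 𝓘(ℂ) 𝓘(ℂ) (f i)) ∧ (∀ i, K (f i) = 0) ∧
    LinearIndependent ℂ f ∧
    ∀ g : ℍ → ℂ, MDifferentiable 𝓘(ℂ) 𝓘(ℂ) g → K g = 0 → g ∈ Submodule.span ℂ (Set.range f)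


/-- `F = (f_0, …, f_r)ᵀ` is a quasimodular vector of weight `w` and dimension `r+1`:
all components are holomorphic and there is a quasimodular form `f = ∑_{ℓ=0}^s E_2^ℓ h_ℓ`
of weight `w` and depth `s ≤ r` such that
`f_k(z) = ∑_{ℓ=0}^{min(k,s)} C(k,ℓ) z^{k-ℓ} g_ℓ(z)` for the attached forms `g_ℓ`. -/
def IsQuasimodularVector (w : ℤ) (r : ℕ) (F : Fin (r + 1) → ℍ → ℂ) : Prop :=
  (∀ k, MDifferentiable 𝓘(ℂ) 𝓘(ℂ) (F k)) ∧
  ∃ s : ℕ, s ≤ r ∧ ∃ h : ℕ → ℍ → ℂ,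
    (∀ ℓ ≤ s, h ℓ ∈ Mset (w - 2 * ℓ)) ∧ (s = 0 ∨ h s ≠ 0) ∧
    ∀ (k : Fin (r + 1)) (z : ℍ),
      F k z = ∑ ℓ ∈ Finset.range (min (k : ℕ) s + 1),
        (((k : ℕ).choose ℓ : ℕ) : ℂ) * (z : ℂ) ^ ((k : ℕ) - ℓ) * gOf s h ℓ z

/-- The modular Wronskian `W(z) = det(F, ∂_{w-r}F, …, ∂_{w-r}^r F)`. -/
def modularWronskian (w : ℤ) (r : ℕ) (F : Fin (r + 1) → ℍ → ℂ) (z : ℍ) : ℂ :=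
  Matrix.det (Matrix.of fun (k j : Fin (r + 1)) => serreIter (w - r) (j : ℕ) (F k) z)

end

open PowerSeries (coeff)

/-- `f` is given on all of `ℍ` by the convergent `q`-expansion with coefficients those of `a`. -/
def HasQ (f : ℍ → ℂ) (a : PowerSeries ℂ) : Prop :=
  ∀ z : ℍ, HasSum (fun n : ℕ => coeff n a * qexp z ^ n) (f z)

/-- The derivation `q d/dq` on power series. -/
noncomputable def qD (a : PowerSeries ℂ) : PowerSeries ℂ :=
  PowerSeries.X * PowerSeries.derivative ℂ a

lemma coeff_qD (a : PowerSeries ℂ) (n : ℕ) : coeff n (qD a) = n * coeff n a := by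
  rcases n with _ | n
  · simp [qD]
  · rw [qD, mul_comm, PowerSeries.coeff_succ_mul_X, PowerSeries.coeff_derivative]
    push_cast
    ring

lemma qD_add (a b : PowerSeries ℂ) : qD (a + b) = qD a + qD b := by
  simp [qD, mul_add]

lemma qD_smul (c : ℂ) (a : PowerSeries ℂ) : qD (c • a) = c • qD a := by
  simp [qD]

lemma qD_mul (a b : PowerSeries ℂ) : qD (a * b) = qD a * b + a * qD b := by
  simp only [qD, Derivation.leibniz, smul_eq_mul]
  ring

lemma qD_X_pow (m : ℕ) : qD (PowerSeries.X ^ m) = (m : ℂ) • (PowerSeries.X ^ m) := by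
  ext n
  rw [coeff_qD, PowerSeries.coeff_smul, PowerSeries.coeff_X_pow]
  split_ifs with h <;> simp [h]

lemma qexp_eq_qParam (z : ℍ) : qexp z = Function.Periodic.qParam 1 z := by
  simp [qexp, Function.Periodic.qParam]

lemma norm_qexp (z : ℍ) : ‖qexp z‖ = Real.exp (-(2 * π * z.im)) := by
  rw [qexp, Complex.norm_exp]
  congr 1
  simp

lemma hderiv_eq (f : ℍ → ℂ) (z : ℍ) : hderiv f z = deriv (f ∘ ofComplex) z := by
  unfold hderiv
  refine Filter.EventuallyEq.deriv_eq ?_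
  filter_upwards [isOpen_upperHalfPlaneSet.mem_nhds z.im_pos] with w hw
  have hw' : 0 < w.im := hw
  simp [hw', ofComplex_apply_of_im_pos hw']

namespace HasQ

variable {f g : ℍ → ℂ} {a b : PowerSeries ℂ}

lemma hasSum_qParam (h : HasQ f a) (z : ℍ) :
    HasSum (fun n : ℕ => coeff n a • Function.Periodic.qParam 1 z ^ n) (f z) := by
  simpa [← qexp_eq_qParam] using h z

lemma eq_fun (hf : HasQ f a) (hg : HasQ g a) : f = g :=
  funext fun z => (hf z).unique (hg z)

lemma add (hf : HasQ f a) (hg : HasQ g b) : HasQ (f + g) (a + b) := fun z => by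
  simpa [add_mul] using (hf z).add (hg z)

lemma smul (c : ℂ) (hf : HasQ f a) : HasQ (c • f) (c • a) := fun z => by
  simpa [mul_assoc] using (hf z).mul_left c

lemma sub (hf : HasQ f a) (hg : HasQ g b) : HasQ (f - g) (a - b) := fun z => by
  simpa [sub_mul] using (hf z).sub (hg z)

lemma zero : HasQ 0 0 := fun z => by simp

lemma one : HasQ 1 1 := fun z => by
  have := hasSum_ite_eq (0 : ℕ) (1 : ℂ)
  refine this.congr_fun fun n => ?_
  rcases n with _ | n <;> simp [PowerSeries.coeff_one]

lemma mul (hf : HasQ f a) (hg : HasQ g b) : HasQ (f * g) (a * b) := fun z => by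
  have hs := summable_norm_sum_mul_antidiagonal_of_summable_norm (hf z).summable.norm
    (hg z).summable.norm
  have := tsum_mul_tsum_eq_tsum_sum_antidiagonal_of_summable_norm (hf z).summable.norm
    (hg z).summable.norm
  rw [(hf z).tsum_eq, (hg z).tsum_eq] at this
  have h2 := hs.of_norm.hasSum
  rw [← this] at h2
  refine h2.congr_fun fun n => ?_
  rw [PowerSeries.coeff_mul, Finset.sum_mul]
  refine Finset.sum_congr rfl fun p hp => ?_
  rw [← Finset.HasAntidiagonal.mem_antidiagonal.mp hp, pow_add]
  ring

lemma pow (hf : HasQ f a) (n : ℕ) : HasQ (f ^ n) (a ^ n) := by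
  induction n with
  | zero => simpa using one
  | succ n ih => simpa [pow_succ] using ih.mul hf

lemma eventually_eq_tsum (hf : HasQ f a) (z : ℍ) :
    f ∘ ofComplex =ᶠ[nhds (z : ℂ)]
      fun w => ∑' n : ℕ, coeff n a * Complex.exp (2 * π * Complex.I * w) ^ n := by
  filter_upwards [isOpen_upperHalfPlaneSet.mem_nhds z.im_pos] with w hw
  have hw' : 0 < w.im := hw
  simpa [qexp, ofComplex_apply_of_im_pos hw'] using (hf ⟨w, hw'⟩).tsum_eq.symm

/-- Locally uniform summability data for the `q`-expansion, as a function of `z`. -/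
lemma exists_bound (hf : HasQ f a) (z : ℍ) : ∃ (U : Set ℂ) (u : ℕ → ℝ), IsOpen U ∧ (z : ℂ) ∈ U ∧
    Summable u ∧
    ∀ (n : ℕ) (w : ℂ), w ∈ U → ‖coeff n a * Complex.exp (2 * π * Complex.I * w) ^ n‖ ≤ u n := by
  have hz := z.im_pos
  let z₀ : ℍ := ⟨(z.im / 2 : ℝ) * Complex.I, by simpa using hz⟩
  refine ⟨{w | z.im / 2 < w.im}, fun n => ‖coeff n a * qexp z₀ ^ n‖,
    isOpen_lt continuous_const Complex.continuous_im, ?_, (hf z₀).summable.norm, ?_⟩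
  · change z.im / 2 < z.im
    linarith
  · intro n w hw
    have hw1 : z.im / 2 < w.im := hw
    have hw' : 0 < w.im := by linarith
    have h1 : ‖Complex.exp (2 * π * Complex.I * w)‖ ≤ ‖qexp z₀‖ := by
      have := norm_qexp ⟨w, hw'⟩
      rw [qexp] at this
      rw [this, norm_qexp]
      have h3 : z₀.im = z.im / 2 := by
        change ((z.im / 2 : ℝ) * Complex.I : ℂ).im = _
        simp
      rw [h3]
      refine Real.exp_le_exp.mpr (neg_le_neg ?_)
      exact mul_le_mul_of_nonneg_left hw1.le (by positivity)
    simp only [norm_mul, norm_pow]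
    gcongr

lemma differentiableOn_term (a : PowerSeries ℂ) (U : Set ℂ) (n : ℕ) :
    DifferentiableOn ℂ (fun w => coeff n a * Complex.exp (2 * π * Complex.I * w) ^ n) U := by
  fun_prop

lemma mdiff (hf : HasQ f a) : MDifferentiable 𝓘(ℂ) 𝓘(ℂ) f := fun z => by
  rw [UpperHalfPlane.mdifferentiableAt_iff]
  obtain ⟨U, u, hU, hz, hu, hb⟩ := hf.exists_bound z
  exact ((differentiableOn_tsum_of_summable_norm hu (fun n => differentiableOn_term a U n) hU
    hb).differentiableAt (hU.mem_nhds hz)).congr_of_eventuallyEq (hf.eventually_eq_tsum z)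

lemma qderiv (hf : HasQ f a) : HasQ (qderiv f) (qD a) := fun z => by
  obtain ⟨U, u, hU, hz, hu, hb⟩ := hf.exists_bound z
  have h1 := hasSum_deriv_of_summable_norm hu (fun n => differentiableOn_term a U n) hU hb hz
  rw [← (hf.eventually_eq_tsum z).deriv_eq, ← hderiv_eq] at h1
  have h2 := h1.mul_left (2 * π * Complex.I)⁻¹
  refine h2.congr_fun fun n => ?_
  have h3 : HasDerivAt (fun w : ℂ => coeff n a * Complex.exp (2 * π * Complex.I * w) ^ n)
      (coeff n a * (n * Complex.exp (2 * π * Complex.I * z) ^ (n - 1) *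
        (Complex.exp (2 * π * Complex.I * z) * (2 * π * Complex.I * 1)))) z :=
    ((((hasDerivAt_id (z : ℂ)).const_mul (2 * π * Complex.I)).cexp).pow n).const_mul _
  rw [h3.deriv, coeff_qD, qexp]
  have hpi : (2 * π * Complex.I : ℂ) ≠ 0 := Complex.two_pi_I_ne_zero
  rcases n with _ | n
  · simp
  · simp only [Nat.add_sub_cancel, pow_succ]
    field_simp

lemma bounded (hf : HasQ f a) : IsBoundedAtImInfty f :=
  isBoundedAtImInfty_of_hasSum_qExpansion one_pos hf.hasSum_qParam

lemma periodic (hf : HasQ f a) : Function.Periodic (f ∘ ofComplex) (1 : ℝ) := by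
  intro w
  by_cases hw : 0 < w.im
  · have hw' : 0 < (w + (1 : ℝ)).im := by simpa using hw
    simp only [Function.comp_apply, ofComplex_apply_of_im_pos hw, ofComplex_apply_of_im_pos hw']
    have hq : qexp ⟨w + (1 : ℝ), hw'⟩ = qexp ⟨w, hw⟩ := by
      simp only [qexp]
      push_cast
      rw [mul_add, mul_one, Complex.exp_add, Complex.exp_two_pi_mul_I, mul_one]
    have h1 := hf ⟨w + (1 : ℝ), hw'⟩
    rw [hq] at h1
    exact h1.unique (hf _)
  · have hw' : ¬ 0 < (w + (1 : ℝ)).im := by simpa using hw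
    rw [Function.comp_apply, Function.comp_apply, ofComplex_apply_of_im_nonpos (not_lt.mp hw),
      ofComplex_apply_of_im_nonpos (not_lt.mp hw')]

lemma unique (hf : HasQ f a) (hf' : HasQ f b) : a = b := by
  have han := analyticAt_cuspFunction_zero one_pos hf.periodic hf.mdiff hf.bounded
  have h1 := (hasFPowerSeriesOnBall_cuspFunction one_pos han hf.hasSum_qParam).hasFPowerSeriesAt
  have h2 := (hasFPowerSeriesOnBall_cuspFunction one_pos han hf'.hasSum_qParam).hasFPowerSeriesAt
  ext n
  simpa using congr_arg (FormalMultilinearSeries.coeff · n) (h1.eq_formalMultilinearSeries h2)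

end HasQ

/-- The power series of the normalized Eisenstein series of weight `k`. -/
noncomputable def eisSeries (k : ℕ) : PowerSeries ℂ :=
  PowerSeries.mk fun m => if m = 0 then 1 else
    -(2 * k / ((bernoulli k : ℚ) : ℂ)) * (ArithmeticFunction.sigma (k - 1) m : ℂ)

lemma hasQ_Eis {k : ℕ} (hk : 1 ≤ k) : HasQ (Eis k) (eisSeries k) := fun z => by
  have hS : Summable fun n : ℕ =>
      (ArithmeticFunction.sigma (k - 1) (n + 1) : ℂ) * qexp z ^ (n + 1) :=
    (summable_nat_add_iff 1).mpr (EisensteinSeries.summable_sigma_mul_cexp_pow hk z)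
  rw [← hasSum_nat_add_iff' 1]
  have h := hS.hasSum.mul_left (-(2 * k / ((bernoulli k : ℚ) : ℂ)))
  have e : Eis k z - ∑ i ∈ range 1, coeff i (eisSeries k) * qexp z ^ i =
      -(2 * k / ((bernoulli k : ℚ) : ℂ)) *
        ∑' n : ℕ, (ArithmeticFunction.sigma (k - 1) (n + 1) : ℂ) * qexp z ^ (n + 1) := by
    simp [eisSeries, Eis]
  rw [e]
  refine h.congr_fun fun n => ?_
  simp [eisSeries]
  ring

lemma bernoulli_four : bernoulli 4 = -1 / 30 := by decide +kernel

lemma bernoulli_six : bernoulli 6 = 1 / 42 := by decide +kernel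

lemma Eis_two : Eis 2 = EisensteinSeries.E2 := by
  ext z
  rw [EisensteinSeries.E2_eq_tsum_cexp,
    tsum_pnat_eq_tsum_succ (f := fun n => (ArithmeticFunction.sigma 1 n : ℂ) *
      Complex.exp (2 * π * Complex.I * z) ^ n), Eis, bernoulli_two]
  norm_num [qexp]

lemma Eis_eq_E {k : ℕ} (hk : 3 ≤ k) (hk2 : Even k) : Eis k = ⇑(ModularForm.E hk) := by
  ext z
  rw [EisensteinSeries.q_expansion_bernoulli hk hk2]
  simp_rw [zpow_natCast]
  rw [tsum_pnat_eq_tsum_succ (f := fun n => (ArithmeticFunction.sigma (k - 1) n : ℂ) *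
      Complex.exp (2 * π * Complex.I * z) ^ n), Eis]
  norm_num [qexp]

/-- The power series of `E_2`. -/
noncomputable abbrev Pser : PowerSeries ℂ := eisSeries 2

/-- The power series of `E_4`. -/
noncomputable abbrev Qser : PowerSeries ℂ := eisSeries 4

/-- The power series of `E_6`. -/
noncomputable abbrev Rser : PowerSeries ℂ := eisSeries 6

lemma sigma_two (k : ℕ) : ArithmeticFunction.sigma k 2 = 1 + 2 ^ k := by
  rw [ArithmeticFunction.sigma_apply, Nat.Prime.divisors Nat.prime_two]
  simp

lemma coeff_P_zero : coeff 0 Pser = 1 := by simp [eisSeries]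
lemma coeff_P_one : coeff 1 Pser = -24 := by norm_num [eisSeries, bernoulli_two]
lemma coeff_P_two : coeff 2 Pser = -72 := by norm_num [eisSeries, bernoulli_two, sigma_two]
lemma coeff_Q_zero : coeff 0 Qser = 1 := by simp [eisSeries]
lemma coeff_Q_one : coeff 1 Qser = 240 := by norm_num [eisSeries, bernoulli_four]
lemma coeff_Q_two : coeff 2 Qser = 2160 := by norm_num [eisSeries, bernoulli_four, sigma_two]
lemma coeff_R_zero : coeff 0 Rser = 1 := by simp [eisSeries]
lemma coeff_R_one : coeff 1 Rser = -504 := by norm_num [eisSeries, bernoulli_six]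
lemma coeff_R_two : coeff 2 Rser = -16632 := by norm_num [eisSeries, bernoulli_six, sigma_two]

open scoped ModularForm

lemma coe_top_eq_SL : ((⊤ : Subgroup SL(2, ℤ)) : Subgroup (GL (Fin 2) ℝ)) = 𝒮ℒ :=
  (MonoidHom.range_eq_map _).symm

lemma mem_Mset_iff_exists {k : ℤ} {f : ℍ → ℂ} :
    f ∈ Mset k ↔ ∃ F : ModularForm 𝒮ℒ k, ⇑F = f :=
  ⟨fun ⟨F, hF⟩ => ⟨ModularForm.mcast rfl F coe_top_eq_SL.symm, hF⟩,
    fun ⟨F, hF⟩ => ⟨ModularForm.mcast rfl F coe_top_eq_SL, hF⟩⟩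

lemma ModularForm.hasQ {k : ℤ} (F : ModularForm 𝒮ℒ k) : HasQ F (qExpansion 1 F) := fun z => by
  simpa [qexp_eq_qParam] using ModularForm.hasSum_qExpansion F one_pos one_mem_strictPeriods_SL z

/-- Level one modular forms are the slash-invariant functions with a `q`-expansion. -/
lemma mem_Mset_iff {k : ℤ} {f : ℍ → ℂ} :
    f ∈ Mset k ↔ (∃ a, HasQ f a) ∧ ∀ γ : SL(2, ℤ), f ∣[k] γ = f := by
  rw [mem_Mset_iff_exists]
  constructor
  · rintro ⟨F, rfl⟩
    exact ⟨⟨_, F.hasQ⟩, fun γ => F.slash_action_eq' _ ⟨γ, rfl⟩⟩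
  · rintro ⟨⟨a, ha⟩, h⟩
    refine ⟨{ toFun := f, slash_action_eq' := ?_, holo' := ha.mdiff, bdd_at_cusps' := ?_ }, rfl⟩
    · rintro A ⟨γ, rfl⟩
      exact h γ
    · intro c hc
      rw [OnePoint.isBoundedAt_iff_forall_SL2Z hc]
      intro γ _
      rw [h γ]
      exact ha.bounded

namespace Mset

variable {k l : ℤ} {f g : ℍ → ℂ} {a : PowerSeries ℂ}

lemma exists_hasQ (hf : f ∈ Mset k) : ∃ a, HasQ f a := (mem_Mset_iff.mp hf).1

lemma slash (hf : f ∈ Mset k) (γ : SL(2, ℤ)) : f ∣[k] γ = f := (mem_Mset_iff.mp hf).2 γ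

lemma zero : (0 : ℍ → ℂ) ∈ Mset k :=
  mem_Mset_iff.mpr ⟨⟨0, HasQ.zero⟩, fun _ => SlashAction.zero_slash _ _⟩

lemma one : (1 : ℍ → ℂ) ∈ Mset 0 :=
  mem_Mset_iff.mpr ⟨⟨1, HasQ.one⟩, fun γ => by ext z; simp [ModularForm.SL_slash_apply]⟩

lemma add (hf : f ∈ Mset k) (hg : g ∈ Mset k) : f + g ∈ Mset k := by
  obtain ⟨a, ha⟩ := exists_hasQ hf
  obtain ⟨b, hb⟩ := exists_hasQ hg
  exact mem_Mset_iff.mpr ⟨⟨_, ha.add hb⟩, fun γ => by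
    rw [SlashAction.add_slash, slash hf, slash hg]⟩

lemma smul (c : ℂ) (hf : f ∈ Mset k) : c • f ∈ Mset k := by
  obtain ⟨a, ha⟩ := exists_hasQ hf
  exact mem_Mset_iff.mpr ⟨⟨_, ha.smul c⟩, fun γ => by
    rw [ModularForm.SL_smul_slash, slash hf]⟩

lemma mul (hf : f ∈ Mset k) (hg : g ∈ Mset l) : f * g ∈ Mset (k + l) := by
  obtain ⟨a, ha⟩ := exists_hasQ hf
  obtain ⟨b, hb⟩ := exists_hasQ hg
  exact mem_Mset_iff.mpr ⟨⟨_, ha.mul hb⟩, fun γ => by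
    rw [ModularForm.mul_slash_SL2, slash hf, slash hg]⟩

lemma eis {k : ℕ} (hk : 3 ≤ k) (hk2 : Even k) : Eis k ∈ Mset k :=
  mem_Mset_iff_exists.mpr ⟨_, (Eis_eq_E hk hk2).symm⟩

/-- A modular form of weight less than `12` is determined by its constant term. -/
lemma eq_zero_of_weight_lt (hf : f ∈ Mset k) (hk : k < 12) (ha : HasQ f a) (h0 : coeff 0 a = 0) :
    a = 0 := by
  obtain ⟨F, rfl⟩ := mem_Mset_iff_exists.mp hf
  have hF := F.hasQ.unique ha
  have : F = 0 := ModularForm.sturm_bound_levelOne <| by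
    rw [show k.toNat / 12 = 0 by omega, hF]
    exact lt_of_lt_of_le (by simp) (PowerSeries.le_order a 1 fun i hi => by
      obtain rfl : i = 0 := by simpa using hi
      exact h0)
  subst this
  exact ha.unique HasQ.zero

end Mset

/-- `12` times the Serre derivative of weight `k`, on power series. -/
noncomputable def sd (k : ℤ) (a : PowerSeries ℂ) : PowerSeries ℂ :=
  12 * qD a - k * Pser * a

lemma HasQ.intCast_mul {f : ℍ → ℂ} {a : PowerSeries ℂ} (hf : HasQ f a) (n : ℤ) :
    HasQ ((n : ℂ) • f) (n * a) := by
  convert hf.smul n using 1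
  ext m
  rw [PowerSeries.coeff_smul, ← zsmul_eq_mul, map_zsmul, zsmul_eq_mul, smul_eq_mul]

lemma HasQ.serre {f : ℍ → ℂ} {a : PowerSeries ℂ} (hf : HasQ f a) (k : ℤ) :
    HasQ ((12 : ℂ) • serre k f) (sd k a) := by
  have := (hf.qderiv.intCast_mul 12).sub (((hasQ_Eis one_le_two).mul hf).intCast_mul k)
  have e : ((12 : ℂ) • _root_.serre k f) =
      ((12 : ℤ) : ℂ) • _root_.qderiv f - (k : ℂ) • (Eis 2 * f) := by
    ext z
    simp [_root_.serre]
    ring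
  rw [e, sd, mul_assoc]
  exact this

lemma qderiv_eq_normalizedDeriv (f : ℍ → ℂ) :
    qderiv f = Derivative.normalizedDerivOfComplex f := by
  ext z
  rw [qderiv, hderiv_eq, Derivative.normalizedDerivOfComplex]

lemma serre_eq_serreDerivative (k : ℤ) (f : ℍ → ℂ) :
    serre k f = Derivative.serreDerivative k f := by
  ext z
  rw [serre, Eis_two, qderiv_eq_normalizedDeriv, Derivative.serreDerivative_apply]
  ring

lemma Mset.serre {k : ℤ} {f : ℍ → ℂ} (hf : f ∈ Mset k) :
    (12 : ℂ) • serre k f ∈ Mset (k + 2) := by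
  obtain ⟨a, ha⟩ := exists_hasQ hf
  refine mem_Mset_iff.mpr ⟨⟨_, ha.serre k⟩, fun γ => ?_⟩
  rw [ModularForm.SL_smul_slash, serre_eq_serreDerivative]
  exact congr_arg _ (Derivative.serreDerivative_slash_invariant ha.mdiff (slash hf γ))

lemma coeff_zero_intCast_mul (n : ℤ) (a : PowerSeries ℂ) :
    coeff 0 ((n : PowerSeries ℂ) * a) = n * coeff 0 a := by
  simp

lemma coeff_zero_sd (k : ℤ) (a : PowerSeries ℂ) : coeff 0 (sd k a) = -k * coeff 0 a := by
  have := coeff_qD a 0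
  rw [PowerSeries.coeff_zero_eq_constantCoeff_apply] at this
  simp [sd, eisSeries, this]

lemma Mset.eis_four : Eis 4 ∈ Mset 4 := Mset.eis (k := 4) (by norm_num) ⟨2, rfl⟩

lemma Mset.eis_six : Eis 6 ∈ Mset 6 := Mset.eis (k := 6) (by norm_num) ⟨3, rfl⟩

lemma hasQ_Eis_four : HasQ (Eis 4) Qser := hasQ_Eis (by norm_num)

lemma hasQ_Eis_six : HasQ (Eis 6) Rser := hasQ_Eis (by norm_num)

lemma hasQ_Eis_two : HasQ (Eis 2) Pser := hasQ_Eis (by norm_num)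

lemma sd_Q : sd 4 Qser = -4 * Rser := by
  have := Mset.eq_zero_of_weight_lt
    (Mset.add (Mset.serre Mset.eis_four) (Mset.smul ((4 : ℤ) : ℂ) Mset.eis_six)) (by norm_num)
    ((hasQ_Eis_four.serre 4).add (hasQ_Eis_six.intCast_mul 4))
    (by rw [map_add, coeff_zero_sd, coeff_zero_intCast_mul, coeff_Q_zero, coeff_R_zero]; norm_num)
  push_cast at this
  linear_combination this

lemma sd_R : sd 6 Rser = -6 * Qser ^ 2 := by
  have h8 : Eis 4 * Eis 4 ∈ Mset 8 := Mset.mul Mset.eis_four Mset.eis_four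
  have := Mset.eq_zero_of_weight_lt
    (Mset.add (Mset.serre Mset.eis_six) (Mset.smul ((6 : ℤ) : ℂ) h8)) (by norm_num)
    ((hasQ_Eis_six.serre 6).add ((hasQ_Eis_four.mul hasQ_Eis_four).intCast_mul 6))
    (by
      rw [map_add, coeff_zero_sd, coeff_zero_intCast_mul, coeff_R_zero]
      simp [eisSeries])
  push_cast at this
  linear_combination this

lemma hasDerivAt_D2 (γ : SL(2, ℤ)) (z : ℍ) :
    HasDerivAt (EisensteinSeries.D2 γ ∘ ofComplex)
      (-(2 * π * Complex.I) * ((γ 1 0 : ℂ) / denom γ z) ^ 2) z := by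
  have hz := denom_ne_zero γ z
  have h1 := (hasDerivAt_denom_zpow (γ : GL (Fin 2) ℝ) (-1) z).const_mul
      (2 * π * Complex.I * γ 1 0)
  have h2 : (EisensteinSeries.D2 γ ∘ ofComplex) =ᶠ[nhds (z : ℂ)]
      fun w : ℂ => (2 * π * Complex.I * γ 1 0) * denom γ w ^ (-1 : ℤ) := by
    filter_upwards [isOpen_upperHalfPlaneSet.mem_nhds z.im_pos] with w hw
    have hw' : 0 < w.im := hw
    simp [EisensteinSeries.D2, ofComplex_apply_of_im_pos hw', div_eq_mul_inv]
  refine (h1.congr_of_eventuallyEq h2).congr_deriv ?_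
  rw [show (-1 - 1 : ℤ) = -2 by norm_num, zpow_neg]
  simp
  field_simp

lemma normalizedDeriv_D2 (γ : SL(2, ℤ)) (z : ℍ) :
    Derivative.normalizedDerivOfComplex (EisensteinSeries.D2 γ) z =
      -((γ 1 0 : ℂ) / denom γ z) ^ 2 := by
  rw [Derivative.normalizedDerivOfComplex, (hasDerivAt_D2 γ z).deriv]
  have hpi : (2 * π * Complex.I : ℂ) ≠ 0 := Complex.two_pi_I_ne_zero
  field_simp

lemma serre_one_E2_slash (γ : SL(2, ℤ)) :
    Derivative.serreDerivative 1 EisensteinSeries.E2 ∣[(4 : ℤ)] γ =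
      Derivative.serreDerivative 1 EisensteinSeries.E2 := by
  ext z
  have hE := congrFun (EisensteinSeries.E2_slash_action γ) z
  have hD := congrFun (Derivative.normalizedDerivOfComplex_SL_slash (k := 2) (γ := γ)
    E2_mdifferentiable) z
  have hm : MDifferentiable 𝓘(ℂ) 𝓘(ℂ) (EisensteinSeries.D2 γ) := by
    exact fun z => mdifferentiableAt_iff.mpr (hasDerivAt_D2 γ z).differentiableAt
  rw [EisensteinSeries.E2_slash_action, Derivative.normalizedDerivOfComplex_sub _ _
    E2_mdifferentiable (hm.const_smul _),
    Derivative.normalizedDerivOfComplex_smul _ _ hm] at hD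
  simp only [Pi.sub_apply, Pi.smul_apply, normalizedDeriv_D2, smul_eq_mul] at hD hE
  have hsl : (Derivative.serreDerivative 1 EisensteinSeries.E2 ∣[(4 : ℤ)] γ) z =
      (Derivative.normalizedDerivOfComplex EisensteinSeries.E2 ∣[(4 : ℤ)] γ) z -
        12⁻¹ * ((EisensteinSeries.E2 ∣[(2 : ℤ)] γ) z) ^ 2 := by
    have := congrFun (ModularForm.mul_slash_SL2 2 2 γ EisensteinSeries.E2 EisensteinSeries.E2) z
    simp only [ModularForm.SL_slash_apply, Pi.mul_apply, Derivative.serreDerivative_apply] at *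
    rw [pow_two, ← this]
    norm_num
    ring
  rw [hsl, hE, Derivative.serreDerivative_apply]
  have hDE : (Derivative.normalizedDerivOfComplex EisensteinSeries.E2 ∣[(4 : ℤ)] γ) z = _ :=
    (eq_add_of_sub_eq hD.symm)
  rw [hDE, riemannZeta_two, EisensteinSeries.D2]
  have hpi : (π : ℂ) ≠ 0 := by exact_mod_cast Real.pi_ne_zero
  have hz := denom_ne_zero γ z
  field_simp
  ring_nf
  rw [Complex.I_pow_three, Complex.I_sq]
  ring

lemma sd_P : sd 1 Pser = -Qser := by
  have h : (12 : ℂ) • serre 1 (Eis 2) ∈ Mset 4 := by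
    refine mem_Mset_iff.mpr ⟨⟨_, hasQ_Eis_two.serre 1⟩, fun γ => ?_⟩
    rw [ModularForm.SL_smul_slash, serre_eq_serreDerivative, Eis_two]
    exact congr_arg _ (by simpa using serre_one_E2_slash γ)
  have := Mset.eq_zero_of_weight_lt (Mset.add h Mset.eis_four) (by norm_num)
    ((hasQ_Eis_two.serre 1).add hasQ_Eis_four)
    (by rw [map_add, coeff_zero_sd, coeff_P_zero, coeff_Q_zero]; norm_num)
  linear_combination this

lemma twelve_qD_P : 12 * qD Pser = Pser ^ 2 - Qser := by
  have := sd_P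
  rw [sd] at this
  push_cast at this
  linear_combination this

lemma twelve_qD_Q : 12 * qD Qser = 4 * Pser * Qser - 4 * Rser := by
  have := sd_Q
  rw [sd] at this
  push_cast at this
  linear_combination this

lemma twelve_qD_R : 12 * qD Rser = 6 * Pser * Rser - 6 * Qser ^ 2 := by
  have := sd_R
  rw [sd] at this
  push_cast at this
  linear_combination this

/-- The parametrization of `QM_w^3` by quadruples of modular forms. -/
noncomputable def qmMap (w : ℤ) :
    (ModularForm 𝒮ℒ w × ModularForm 𝒮ℒ (w - 2) × ModularForm 𝒮ℒ (w - 4) ×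
      ModularForm 𝒮ℒ (w - 6)) →ₗ[ℂ] (ℍ → ℂ) where
  toFun F := fun z => F.1 z + Eis 2 z * F.2.1 z + Eis 2 z ^ 2 * F.2.2.1 z +
    Eis 2 z ^ 3 * F.2.2.2 z
  map_add' F G := by
    ext z
    simp only [Prod.fst_add, Prod.snd_add, add_apply, Pi.add_apply]
    ring
  map_smul' c F := by
    ext z
    simp only [Prod.smul_fst, Prod.smul_snd, smul_apply, Pi.smul_apply, smul_eq_mul,
      RingHom.id_apply]
    ring

lemma mem_QMset_iff {w : ℤ} {f : ℍ → ℂ} : f ∈ QMset w 3 ↔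
    ∃ h₀ ∈ Mset w, ∃ h₁ ∈ Mset (w - 2), ∃ h₂ ∈ Mset (w - 4), ∃ h₃ ∈ Mset (w - 6),
      f = h₀ + Eis 2 * h₁ + Eis 2 ^ 2 * h₂ + Eis 2 ^ 3 * h₃ := by
  constructor
  · rintro ⟨h, hh, hf⟩
    refine ⟨h 0, by simpa using hh 0 (by norm_num), h 1, by simpa using hh 1 (by norm_num), h 2,
      by simpa using hh 2 (by norm_num), h 3, by simpa using hh 3 (by norm_num), ?_⟩
    ext z
    simp [hf z, Finset.sum_range_succ]
  · rintro ⟨h₀, m₀, h₁, m₁, h₂, m₂, h₃, m₃, rfl⟩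
    refine ⟨fun ℓ => if ℓ = 0 then h₀ else if ℓ = 1 then h₁ else if ℓ = 2 then h₂ else h₃,
      fun ℓ hℓ => ?_, fun z => ?_⟩
    · interval_cases ℓ <;> simpa
    · simp [Finset.sum_range_succ]

lemma range_qmMap (w : ℤ) : LinearMap.range (qmMap w) = QM w 3 := by
  apply le_antisymm
  · rintro _ ⟨F, rfl⟩
    exact Submodule.subset_span (mem_QMset_iff.mpr ⟨_, mem_Mset_iff_exists.mpr ⟨F.1, rfl⟩,
      _, mem_Mset_iff_exists.mpr ⟨F.2.1, rfl⟩, _, mem_Mset_iff_exists.mpr ⟨F.2.2.1, rfl⟩,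
      _, mem_Mset_iff_exists.mpr ⟨F.2.2.2, rfl⟩, rfl⟩)
  · refine Submodule.span_le.mpr fun f hf => ?_
    obtain ⟨h₀, m₀, h₁, m₁, h₂, m₂, h₃, m₃, rfl⟩ := mem_QMset_iff.mp hf
    obtain ⟨F₀, rfl⟩ := mem_Mset_iff_exists.mp m₀
    obtain ⟨F₁, rfl⟩ := mem_Mset_iff_exists.mp m₁
    obtain ⟨F₂, rfl⟩ := mem_Mset_iff_exists.mp m₂
    obtain ⟨F₃, rfl⟩ := mem_Mset_iff_exists.mp m₃
    exact ⟨(F₀, F₁, F₂, F₃), rfl⟩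

lemma mem_QM_iff {w : ℤ} {f : ℍ → ℂ} : f ∈ QM w 3 ↔
    ∃ h₀ ∈ Mset w, ∃ h₁ ∈ Mset (w - 2), ∃ h₂ ∈ Mset (w - 4), ∃ h₃ ∈ Mset (w - 6),
      f = h₀ + Eis 2 * h₁ + Eis 2 ^ 2 * h₂ + Eis 2 ^ 3 * h₃ := by
  constructor
  · intro hf
    rw [← range_qmMap] at hf
    obtain ⟨F, rfl⟩ := hf
    exact ⟨_, mem_Mset_iff_exists.mpr ⟨F.1, rfl⟩,
      _, mem_Mset_iff_exists.mpr ⟨F.2.1, rfl⟩, _, mem_Mset_iff_exists.mpr ⟨F.2.2.1, rfl⟩,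
      _, mem_Mset_iff_exists.mpr ⟨F.2.2.2, rfl⟩, rfl⟩
  · exact fun h => Submodule.subset_span (mem_QMset_iff.mpr h)

/-- The matrix `S T^n`, with bottom row `(1, n)`. -/
def bottomRow (n : ℕ) : SL(2, ℤ) := ⟨!![0, -1; 1, n], by simp⟩

lemma denom_bottomRow (n : ℕ) (z : ℍ) : denom (bottomRow n) z = z + n := by
  rw [ModularGroup.denom_apply, show bottomRow n 1 0 = 1 from rfl,
    show bottomRow n 1 1 = (n : ℤ) from rfl]
  push_cast
  ring

lemma Mset.apply_smul {k : ℤ} {f : ℍ → ℂ} (hf : f ∈ Mset k) (γ : SL(2, ℤ)) (z : ℍ) :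
    f (γ • z) = denom γ z ^ k * f z := by
  have h := congrFun (slash hf γ) z
  have hz := denom_ne_zero γ z
  rw [ModularForm.SL_slash_apply, zpow_neg] at h
  rw [← h]
  field_simp

lemma Eis_two_bottomRow_smul (n : ℕ) (z : ℍ) :
    Eis 2 (bottomRow n • z) = (z + n : ℂ) ^ 2 * (Eis 2 z - 6 * Complex.I / π * (z + n : ℂ)⁻¹) := by
  have h := congrFun (EisensteinSeries.E2_slash_action (bottomRow n)) z
  have hz := denom_ne_zero (bottomRow n) z
  have hpi : (π : ℂ) ≠ 0 := by exact_mod_cast Real.pi_ne_zero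
  rw [← Eis_two, ModularForm.SL_slash_apply, zpow_neg] at h
  simp only [Pi.sub_apply, Pi.smul_apply, smul_eq_mul, EisensteinSeries.D2, riemannZeta_two] at h
  rw [denom_bottomRow] at h hz
  have h10 : bottomRow n 1 0 = 1 := rfl
  rw [h10] at h
  rw [show Eis 2 z - 6 * Complex.I / π * (z + n : ℂ)⁻¹ =
      Eis 2 z - 1 / (2 * ((π : ℂ) ^ 2 / 6)) * (2 * π * Complex.I * ((1 : ℤ) : ℂ) / (z + n)) by
    push_cast; field_simp, ← h]
  field_simp

lemma qmMap_injective (w : ℤ) : Function.Injective (qmMap w) := by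
  rw [← LinearMap.ker_eq_bot, LinearMap.ker_eq_bot']
  rintro ⟨F₀, F₁, F₂, F₃⟩ hF
  have key (z : ℍ) : F₀ z = 0 ∧ F₁ z = 0 ∧ F₂ z = 0 ∧ F₃ z = 0 := by
    let p : Polynomial ℂ := Polynomial.C (F₀ z) + Polynomial.C (F₁ z) * Polynomial.X +
      Polynomial.C (F₂ z) * Polynomial.X ^ 2 + Polynomial.C (F₃ z) * Polynomial.X ^ 3
    let t : ℕ → ℂ := fun n => Eis 2 z - 6 * Complex.I / π * (z + n : ℂ)⁻¹
    have hpi : (π : ℂ) ≠ 0 := by exact_mod_cast Real.pi_ne_zero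
    have ht : Function.Injective t := fun n m hnm => by
      have h1 : (6 * Complex.I / π : ℂ) ≠ 0 := by simp [hpi]
      have h2 := mul_left_cancel₀ h1 (sub_right_injective hnm)
      have h3 := inv_injective h2
      exact_mod_cast add_left_cancel h3
    have hroot (n : ℕ) : p.IsRoot (t n) := by
      have h := congrFun hF (bottomRow n • z)
      have hz := denom_ne_zero (bottomRow n) z
      have h0 := Mset.apply_smul (mem_Mset_iff_exists.mpr ⟨F₀, rfl⟩) (bottomRow n) z
      have h1 := Mset.apply_smul (mem_Mset_iff_exists.mpr ⟨F₁, rfl⟩) (bottomRow n) z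
      have h2 := Mset.apply_smul (mem_Mset_iff_exists.mpr ⟨F₂, rfl⟩) (bottomRow n) z
      have h3 := Mset.apply_smul (mem_Mset_iff_exists.mpr ⟨F₃, rfl⟩) (bottomRow n) z
      rw [denom_bottomRow] at hz h0 h1 h2 h3
      change F₀ (bottomRow n • z) + Eis 2 (bottomRow n • z) * F₁ (bottomRow n • z) +
        Eis 2 (bottomRow n • z) ^ 2 * F₂ (bottomRow n • z) +
        Eis 2 (bottomRow n • z) ^ 3 * F₃ (bottomRow n • z) = 0 at h
      rw [Eis_two_bottomRow_smul, h0, h1, h2, h3, zpow_sub₀ hz, zpow_sub₀ hz, zpow_sub₀ hz] at h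
      have hw : (z + n : ℂ) ^ w ≠ 0 := zpow_ne_zero _ hz
      have e : (z + n : ℂ) ^ w * p.eval (t n) = 0 := by
        rw [← h]
        simp only [p, t, Polynomial.eval_add, Polynomial.eval_mul, Polynomial.eval_C,
          Polynomial.eval_X, Polynomial.eval_pow]
        rw [show (z + n : ℂ) ^ (2 : ℤ) = (z + n : ℂ) ^ 2 by norm_cast,
          show (z + n : ℂ) ^ (4 : ℤ) = (z + n : ℂ) ^ 4 by norm_cast,
          show (z + n : ℂ) ^ (6 : ℤ) = (z + n : ℂ) ^ 6 by norm_cast]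
        generalize Eis 2 z - 6 * Complex.I / π * (z + n : ℂ)⁻¹ = s
        field_simp
      exact (mul_eq_zero.mp e).resolve_left hw
    have hp : p = 0 := Polynomial.eq_zero_of_infinite_isRoot p
      (Set.infinite_of_injective_forall_mem ht hroot)
    have hc (i : ℕ) : p.coeff i = 0 := by rw [hp, Polynomial.coeff_zero]
    have c0 := hc 0
    have c1 := hc 1
    have c2 := hc 2
    have c3 := hc 3
    simp [p, Polynomial.coeff_X, Polynomial.coeff_C, Polynomial.coeff_X_pow] at c0 c1 c2 c3
    exact ⟨c0, c1, c2, c3⟩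
  simp only [Prod.mk_eq_zero]
  exact ⟨ModularForm.ext fun z => (key z).1, ModularForm.ext fun z => (key z).2.1,
    ModularForm.ext fun z => (key z).2.2.1, ModularForm.ext fun z => (key z).2.2.2⟩

lemma finrank_modularForm {k : ℕ} (hk : Even k) : Module.finrank ℂ (ModularForm 𝒮ℒ (k : ℤ)) =
    if k % 12 = 2 then k / 12 else k / 12 + 1 := by
  apply Module.finrank_eq_of_rank_eq
  rw [ModularForm.dimension_level_one k hk]
  simp only [Nat.ModEq, Nat.reduceMod]
  split_ifs with h <;> simp [h]

lemma dimQM_three {w : ℕ} (hw : Even w) (h6 : 6 ≤ w) : dimQM w 3 = w / 3 + 1 := by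
  rw [dimQM, ← range_qmMap, LinearMap.finrank_range_of_inj (qmMap_injective _),
    Module.finrank_prod, Module.finrank_prod, Module.finrank_prod,
    show (w : ℤ) - 2 = ((w - 2 : ℕ) : ℤ) by omega, show (w : ℤ) - 4 = ((w - 4 : ℕ) : ℤ) by omega,
    show (w : ℤ) - 6 = ((w - 6 : ℕ) : ℤ) by omega, finrank_modularForm hw,
    finrank_modularForm (by grind), finrank_modularForm (by grind), finrank_modularForm (by grind)]
  obtain ⟨m, rfl⟩ := hw
  split_ifs <;> omega

lemma QM.exists_hasQ {w : ℤ} {f : ℍ → ℂ} (hf : f ∈ QM w 3) : ∃ a, HasQ f a := by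
  obtain ⟨h₀, m₀, h₁, m₁, h₂, m₂, h₃, m₃, rfl⟩ := mem_QM_iff.mp hf
  obtain ⟨a₀, q₀⟩ := Mset.exists_hasQ m₀
  obtain ⟨a₁, q₁⟩ := Mset.exists_hasQ m₁
  obtain ⟨a₂, q₂⟩ := Mset.exists_hasQ m₂
  obtain ⟨a₃, q₃⟩ := Mset.exists_hasQ m₃
  exact ⟨_, ((q₀.add (hasQ_Eis_two.mul q₁)).add ((hasQ_Eis_two.pow 2).mul q₂)).add
    ((hasQ_Eis_two.pow 3).mul q₃)⟩

/-- The `q`-expansion map on `QM_w^3`. -/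
noncomputable def qmSeries (w : ℤ) : QM w 3 →ₗ[ℂ] PowerSeries ℂ where
  toFun f := (QM.exists_hasQ f.2).choose
  map_add' f g := (QM.exists_hasQ (f + g).2).choose_spec.unique
    ((QM.exists_hasQ f.2).choose_spec.add (QM.exists_hasQ g.2).choose_spec)
  map_smul' c f := (QM.exists_hasQ (c • f).2).choose_spec.unique
    ((QM.exists_hasQ f.2).choose_spec.smul c)

lemma hasQ_qmSeries {w : ℤ} (f : QM w 3) : HasQ f (qmSeries w f) :=
  (QM.exists_hasQ f.2).choose_spec

/-- The space of `q`-expansions of elements of `QM_w^3`. -/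
noncomputable def QMser (w : ℤ) : Submodule ℂ (PowerSeries ℂ) := LinearMap.range (qmSeries w)

lemma mem_QMser_iff {w : ℤ} {a : PowerSeries ℂ} : a ∈ QMser w ↔ ∃ f ∈ QM w 3, HasQ f a := by
  constructor
  · rintro ⟨f, rfl⟩
    exact ⟨f, f.2, hasQ_qmSeries f⟩
  · rintro ⟨f, hf, ha⟩
    exact ⟨⟨f, hf⟩, (hasQ_qmSeries _).unique ha⟩

lemma finrank_QMser {w : ℕ} (hw : Even w) (h6 : 6 ≤ w) :
    Module.finrank ℂ (QMser w) = w / 3 + 1 := by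
  rw [QMser, LinearMap.finrank_range_of_inj, ← dimQM_three hw h6, dimQM]
  intro f g hfg
  have h := hasQ_qmSeries f
  rw [hfg] at h
  exact Subtype.ext (h.eq_fun (hasQ_qmSeries g))

/-- The space of `q`-expansions of modular forms of weight `k`. -/
def Mser (k : ℤ) : Set (PowerSeries ℂ) := {a | ∃ f ∈ Mset k, HasQ f a}

namespace Mser

variable {k l : ℤ} {a b : PowerSeries ℂ}

lemma zero : (0 : PowerSeries ℂ) ∈ Mser k := ⟨0, Mset.zero, HasQ.zero⟩

lemma one : (1 : PowerSeries ℂ) ∈ Mser 0 := ⟨1, Mset.one, HasQ.one⟩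

lemma Q : Qser ∈ Mser 4 := ⟨_, Mset.eis_four, hasQ_Eis_four⟩

lemma R : Rser ∈ Mser 6 := ⟨_, Mset.eis_six, hasQ_Eis_six⟩

lemma add (ha : a ∈ Mser k) (hb : b ∈ Mser k) : a + b ∈ Mser k := by
  obtain ⟨f, hf, qf⟩ := ha
  obtain ⟨g, hg, qg⟩ := hb
  exact ⟨_, Mset.add hf hg, qf.add qg⟩

lemma intCast_mul (n : ℤ) (ha : a ∈ Mser k) : n * a ∈ Mser k := by
  obtain ⟨f, hf, qf⟩ := ha
  exact ⟨_, Mset.smul n hf, qf.intCast_mul n⟩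

lemma mul (ha : a ∈ Mser k) (hb : b ∈ Mser l) : a * b ∈ Mser (k + l) := by
  obtain ⟨f, hf, qf⟩ := ha
  obtain ⟨g, hg, qg⟩ := hb
  exact ⟨_, Mset.mul hf hg, qf.mul qg⟩

lemma sd (ha : a ∈ Mser k) : sd k a ∈ Mser (k + 2) := by
  obtain ⟨f, hf, qf⟩ := ha
  exact ⟨_, Mset.serre hf, qf.serre k⟩

end Mser

lemma mem_QMser_iff_exists {w : ℤ} {a : PowerSeries ℂ} : a ∈ QMser w ↔
    ∃ a₀ ∈ Mser w, ∃ a₁ ∈ Mser (w - 2), ∃ a₂ ∈ Mser (w - 4), ∃ a₃ ∈ Mser (w - 6),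
      a = a₀ + Pser * a₁ + Pser ^ 2 * a₂ + Pser ^ 3 * a₃ := by
  rw [mem_QMser_iff]
  constructor
  · rintro ⟨f, hf, hfa⟩
    obtain ⟨h₀, m₀, h₁, m₁, h₂, m₂, h₃, m₃, rfl⟩ := mem_QM_iff.mp hf
    obtain ⟨a₀, q₀⟩ := Mset.exists_hasQ m₀
    obtain ⟨a₁, q₁⟩ := Mset.exists_hasQ m₁
    obtain ⟨a₂, q₂⟩ := Mset.exists_hasQ m₂
    obtain ⟨a₃, q₃⟩ := Mset.exists_hasQ m₃
    exact ⟨a₀, ⟨h₀, m₀, q₀⟩, a₁, ⟨h₁, m₁, q₁⟩, a₂, ⟨h₂, m₂, q₂⟩, a₃, ⟨h₃, m₃, q₃⟩,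
      hfa.unique (((q₀.add (hasQ_Eis_two.mul q₁)).add ((hasQ_Eis_two.pow 2).mul q₂)).add
        ((hasQ_Eis_two.pow 3).mul q₃))⟩
  · rintro ⟨a₀, ⟨h₀, m₀, q₀⟩, a₁, ⟨h₁, m₁, q₁⟩, a₂, ⟨h₂, m₂, q₂⟩, a₃, ⟨h₃, m₃, q₃⟩, rfl⟩
    exact ⟨_, mem_QM_iff.mpr ⟨h₀, m₀, h₁, m₁, h₂, m₂, h₃, m₃, rfl⟩,
      ((q₀.add (hasQ_Eis_two.mul q₁)).add ((hasQ_Eis_two.pow 2).mul q₂)).add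
        ((hasQ_Eis_two.pow 3).mul q₃)⟩

lemma qD_sub (a b : PowerSeries ℂ) : qD (a - b) = qD a - qD b := by
  ext n
  simp only [coeff_qD, map_sub]
  ring

lemma QMser.mul {w k : ℤ} {a b : PowerSeries ℂ} (hb : b ∈ Mser k) (ha : a ∈ QMser w) :
    b * a ∈ QMser (w + k) := by
  obtain ⟨a₀, h₀, a₁, h₁, a₂, h₂, a₃, h₃, rfl⟩ := mem_QMser_iff_exists.mp ha
  refine mem_QMser_iff_exists.mpr ⟨_, Mser.mul h₀ hb, a₁ * b, ?_, a₂ * b, ?_, a₃ * b, ?_, by ring⟩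
  · convert Mser.mul h₁ hb using 1
    ring_nf
  · convert Mser.mul h₂ hb using 1
    ring_nf
  · convert Mser.mul h₃ hb using 1
    ring_nf

/-- The Serre derivative of weight `w - 3` maps `QM_w^3` to `QM_{w+2}^3`. -/
lemma QMser.sd {w : ℤ} {a : PowerSeries ℂ} (ha : a ∈ QMser w) : sd (w - 3) a ∈ QMser (w + 2) := by
  obtain ⟨a₀, h₀, a₁, h₁, a₂, h₂, a₃, h₃, rfl⟩ := mem_QMser_iff_exists.mp ha
  refine mem_QMser_iff_exists.mpr
    ⟨_root_.sd w a₀ + (-1 : ℤ) * (a₁ * Qser), Mser.add (Mser.sd h₀) (Mser.intCast_mul _ ?_),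
      _root_.sd (w - 2) a₁ + ((3 : ℤ) * a₀ + (-2 : ℤ) * (a₂ * Qser)),
        Mser.add ?_ (Mser.add (Mser.intCast_mul _ ?_) (Mser.intCast_mul _ ?_)),
      _root_.sd (w - 4) a₂ + ((2 : ℤ) * a₁ + (-3 : ℤ) * (a₃ * Qser)),
        Mser.add ?_ (Mser.add (Mser.intCast_mul _ ?_) (Mser.intCast_mul _ ?_)),
      _root_.sd (w - 6) a₃ + (1 : ℤ) * a₂, Mser.add ?_ (Mser.intCast_mul _ ?_), ?_⟩
  · convert Mser.mul h₁ Mser.Q using 1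
    ring_nf
  · convert Mser.sd h₁ using 1
    ring_nf
  · convert h₀ using 1
    ring_nf
  · convert Mser.mul h₂ Mser.Q using 1
    ring_nf
  · convert Mser.sd h₂ using 1
    ring_nf
  · convert h₁ using 1
    ring_nf
  · convert Mser.mul h₃ Mser.Q using 1
    ring_nf
  · convert Mser.sd h₃ using 1
    ring_nf
  · convert h₂ using 1
    ring_nf
  · simp only [_root_.sd, qD_add, qD_mul, pow_succ, pow_zero, one_mul]
    push_cast
    linear_combination (a₁ + 2 * Pser * a₂ + 3 * Pser ^ 2 * a₃) * twelve_qD_P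

/-- `QM_w^3` contains an element vanishing to order exactly `j` at infinity. -/
def HasOrder (w : ℤ) (j : ℕ) : Prop :=
  ∃ b : PowerSeries ℂ, PowerSeries.X ^ j * b ∈ QMser w ∧ coeff 0 b ≠ 0

/-- Conjugation of `sd k` by multiplication with `X ^ m`. -/
noncomputable def sdX (m : ℕ) (k : ℤ) (b : PowerSeries ℂ) : PowerSeries ℂ :=
  12 * qD b + (12 * m : ℤ) * b - k * Pser * b

lemma sd_X_pow_mul (k : ℤ) (m : ℕ) (b : PowerSeries ℂ) :
    sd k (PowerSeries.X ^ m * b) = PowerSeries.X ^ m * sdX m k b := by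
  have h : ((m : ℂ) • (PowerSeries.X ^ m : PowerSeries ℂ)) =
      (m : PowerSeries ℂ) * PowerSeries.X ^ m := by
    rw [PowerSeries.smul_eq_C_mul, map_natCast]
  rw [sd, sdX, qD_mul, qD_X_pow, h]
  push_cast
  ring

lemma coeff_intCast_mul (n : ℕ) (k : ℤ) (a : PowerSeries ℂ) :
    coeff n ((k : PowerSeries ℂ) * a) = k * coeff n a := by
  rw [← zsmul_eq_mul, map_zsmul, zsmul_eq_mul]

lemma coeff_mul_zero (a b : PowerSeries ℂ) : coeff 0 (a * b) = coeff 0 a * coeff 0 b := by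
  simp [PowerSeries.coeff_mul]

lemma coeff_mul_one (a b : PowerSeries ℂ) :
    coeff 1 (a * b) = coeff 0 a * coeff 1 b + coeff 1 a * coeff 0 b := by
  simp [PowerSeries.coeff_mul, Finset.Nat.antidiagonal_succ]

lemma coeff_mul_two (a b : PowerSeries ℂ) :
    coeff 2 (a * b) = coeff 0 a * coeff 2 b + coeff 1 a * coeff 1 b + coeff 2 a * coeff 0 b := by
  simp [PowerSeries.coeff_mul, Finset.Nat.antidiagonal_succ, add_assoc]

lemma coeff_sdX (n m : ℕ) (k : ℤ) (b : PowerSeries ℂ) :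
    coeff n (sdX m k b) = (12 * n + 12 * m) * coeff n b - k * coeff n (Pser * b) := by
  rw [sdX, show (12 : PowerSeries ℂ) = ((12 : ℤ) : PowerSeries ℂ) by norm_num, mul_assoc, map_sub,
    map_add, coeff_intCast_mul, coeff_intCast_mul, coeff_intCast_mul, coeff_qD]
  push_cast
  ring

lemma HasOrder.add_two {w : ℤ} {j : ℕ} (hw : Even w) (h : HasOrder w j) : HasOrder (w + 2) j := by
  obtain ⟨b, hb, h0⟩ := h
  have := QMser.sd hb
  rw [sd_X_pow_mul] at this
  refine ⟨_, this, ?_⟩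
  have e : coeff 0 (sdX j (w - 3) b) = ((12 * j - (w - 3) : ℤ) : ℂ) * coeff 0 b := by
    rw [coeff_sdX, coeff_mul_zero, coeff_P_zero]
    push_cast
    ring
  rw [e]
  refine mul_ne_zero (Int.cast_ne_zero.mpr ?_) h0
  obtain ⟨m, rfl⟩ := hw
  omega

lemma HasOrder.of_le {w W : ℕ} {j : ℕ} (hw : Even w) (hW : Even W) (hwW : w ≤ W)
    (h : HasOrder w j) : HasOrder W j := by
  obtain ⟨n, rfl⟩ : ∃ n, W = w + 2 * n := by
    obtain ⟨x, rfl⟩ := hw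
    obtain ⟨y, rfl⟩ := hW
    exact ⟨y - x, by omega⟩
  clear hW hwW
  induction n with
  | zero => exact h
  | succ n ih =>
    convert ih.add_two (by exact_mod_cast hw.add (even_two_mul n)) using 1
    push_cast
    ring

lemma hasOrder_zero : HasOrder 0 0 :=
  ⟨1, by
    rw [pow_zero, one_mul]
    exact mem_QMser_iff_exists.mpr ⟨1, Mser.one, 0, Mser.zero, 0, Mser.zero, 0, Mser.zero,
      by ring⟩, by simp⟩

lemma hasOrder_four_one : HasOrder 4 1 := by
  have hmem : Pser ^ 2 - Qser ∈ QMser 4 := mem_QMser_iff_exists.mpr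
    ⟨(-1 : ℤ) * Qser, Mser.intCast_mul _ Mser.Q, 0,
    Mser.zero, 1, Mser.one, 0, Mser.zero, by push_cast; ring⟩
  obtain ⟨b, hb⟩ : PowerSeries.X ∣ Pser ^ 2 - Qser := by
    rw [PowerSeries.X_dvd_iff, ← twelve_qD_P, ← PowerSeries.coeff_zero_eq_constantCoeff_apply,
      show (12 : PowerSeries ℂ) = PowerSeries.C 12 from (map_ofNat _ 12).symm,
      PowerSeries.coeff_C_mul, coeff_qD]
    simp
  refine ⟨b, by rwa [pow_one, ← hb], ?_⟩
  have h := congrArg (coeff 1) hb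
  rw [← twelve_qD_P, show (12 : PowerSeries ℂ) = PowerSeries.C 12 from (map_ofNat _ 12).symm,
    PowerSeries.coeff_C_mul, coeff_qD, coeff_P_one, PowerSeries.coeff_succ_X_mul] at h
  rw [← h]
  norm_num

/-- If extremal forms exist in all weights, an element of `QM_w^3` is determined by its
first `dim QM_w^3` Fourier coefficients. -/
lemma QMser.eq_zero (hE : ∀ w : ℕ, Even w → 6 ≤ w → HasOrder w (w / 3)) {w : ℕ} (hw : Even w)
    (h6 : 6 ≤ w) {a : PowerSeries ℂ} (ha : a ∈ QMser w) (h0 : ∀ i ≤ w / 3, coeff i a = 0) :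
    a = 0 := by
  have hord (j : Fin (w / 3 + 1)) : HasOrder w j := by
    have hj := j.2
    rcases Nat.even_or_odd (j : ℕ) with ⟨m, hm⟩ | ⟨m, hm⟩
    · rcases Nat.eq_zero_or_pos m with rfl | hm0
      · rw [hm]
        exact hasOrder_zero.of_le (w := 0) (by simp) hw (by omega)
      · refine HasOrder.of_le (w := 6 * m) (by grind) hw (by omega) ?_
        convert hE (6 * m) (by grind) (by omega) using 1
        omega
    · rcases Nat.eq_zero_or_pos m with rfl | hm0
      · rw [hm]
        exact hasOrder_four_one.of_le (w := 4) (by decide) hw (by omega)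
      · refine HasOrder.of_le (w := 6 * m + 4) (by grind) hw (by grind) ?_
        convert hE (6 * m + 4) (by grind) (by omega) using 1
        omega
  choose b hb hb0 using hord
  let φ : QMser w →ₗ[ℂ] (Fin (w / 3 + 1) → ℂ) :=
    LinearMap.pi fun i => (coeff (i : ℕ)).comp (QMser w).subtype
  let M : Matrix (Fin (w / 3 + 1)) (Fin (w / 3 + 1)) ℂ :=
    Matrix.of fun j i => coeff (i : ℕ) (PowerSeries.X ^ (j : ℕ) * b j)
  have hdet : IsUnit M.det := by
    have hM : M.BlockTriangular id := fun j i hij => by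
      simp only [id_eq] at hij
      simp only [M, Matrix.of_apply]
      rw [PowerSeries.coeff_X_pow_mul', if_neg (by simpa using hij)]
    rw [Matrix.det_of_isUpperTriangular hM, isUnit_iff_ne_zero, Finset.prod_ne_zero_iff]
    intro j _
    simpa [M, PowerSeries.coeff_X_pow_mul'] using hb0 j
  have hsurj : Function.Surjective φ := fun v => by
    refine ⟨∑ j, (Matrix.vecMul v M⁻¹) j • ⟨_, hb j⟩, ?_⟩
    have : Matrix.vecMul (Matrix.vecMul v M⁻¹) M = v := by
      rw [Matrix.vecMul_vecMul, Matrix.nonsing_inv_mul _ hdet, Matrix.vecMul_one]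
    conv_rhs => rw [← this]
    generalize Matrix.vecMul v M⁻¹ = c
    ext i
    simp [φ, M, Matrix.vecMul, dotProduct]
  have hfin := finrank_QMser hw h6
  have : FiniteDimensional ℂ (QMser w) := Module.finite_of_finrank_pos (by omega)
  have hinj : Function.Injective φ :=
    (LinearMap.injective_iff_surjective_of_finrank_eq_finrank (by simp [hfin])).mpr hsurj
  have hz : (⟨a, ha⟩ : QMser w) = 0 := hinj <| by
    rw [map_zero]
    ext i
    exact h0 i (by omega)
  exact congrArg Subtype.val hz

/-- The `q`-expansion of a normalized extremal form. -/
lemma IsNormalizedExtremalQM.exists_series {w : ℕ} {f : ℍ → ℂ} (hw : Even w) (h6 : 6 ≤ w)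
    (hf : IsNormalizedExtremalQM w 3 f) : ∃ b : PowerSeries ℂ,
      HasQ f (PowerSeries.X ^ (w / 3) * b) ∧ PowerSeries.X ^ (w / 3) * b ∈ QMser w ∧
      coeff 0 b = 1 := by
  obtain ⟨hmem, a, ha0, ha⟩ := hf
  rw [dimQM_three hw h6, Nat.add_sub_cancel] at ha
  have hq : HasQ f (PowerSeries.X ^ (w / 3) * PowerSeries.mk a) := fun z => by
    rw [← (hasSum_nat_add_iff' (w / 3))]
    have h1 : ∑ i ∈ range (w / 3), coeff i (PowerSeries.X ^ (w / 3) * PowerSeries.mk a) *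
        qexp z ^ i = 0 := Finset.sum_eq_zero fun i hi => by
      rw [PowerSeries.coeff_X_pow_mul', if_neg (by simpa using hi), zero_mul]
    rw [h1, sub_zero]
    refine (ha z).congr_fun fun n => ?_
    rw [PowerSeries.coeff_X_pow_mul, PowerSeries.coeff_mk, add_comm]
  exact ⟨_, hq, mem_QMser_iff.mpr ⟨f, hmem, hq⟩, by simpa using ha0⟩

lemma qD_neg (a : PowerSeries ℂ) : qD (-a) = -qD a := by
  simp [qD]

lemma qD_intCast (n : ℤ) : qD (n : PowerSeries ℂ) = 0 := by
  simp [qD]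

lemma qD_ofNat (n : ℕ) [n.AtLeastTwo] : qD (ofNat(n) : PowerSeries ℂ) = 0 := by
  simpa only [Int.cast_ofNat] using qD_intCast (OfNat.ofNat n)

lemma sd_smul (k : ℤ) (c : ℂ) (a : PowerSeries ℂ) : sd k (c • a) = c • sd k a := by
  rw [sd, qD_smul]
  simp only [PowerSeries.smul_eq_C_mul, sd]
  ring

/-- The left-hand side of the modular differential equation satisfied by the extremal form of
weight `w` and depth `3`. -/
noncomputable def odeLHS (w : ℤ) (a : PowerSeries ℂ) : PowerSeries ℂ :=
  sd (w + 3) (sd (w + 1) (sd (w - 1) (sd (w - 3) a))) +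
    (10 - 6 * w ^ 2 : ℤ) * Qser * sd (w - 1) (sd (w - 3) a) +
    (-8 * w ^ 3 + 24 * w ^ 2 - 40 : ℤ) * Rser * sd (w - 3) a +
    (-3 * w ^ 4 + 24 * w ^ 3 - 54 * w ^ 2 + 81 : ℤ) * Qser ^ 2 * a

lemma odeLHS_smul (w : ℤ) (c : ℂ) (a : PowerSeries ℂ) : odeLHS w (c • a) = c • odeLHS w a := by
  simp only [odeLHS, sd_smul]
  simp only [PowerSeries.smul_eq_C_mul]
  ring

/-- The operator `36 K^up_w` on power series. -/
noncomputable def kup (w : ℤ) (a : PowerSeries ℂ) : PowerSeries ℂ :=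
  (7 * w ^ 2 + 42 * w + 60 : ℤ) * sd (w + 1) (sd (w - 1) (sd (w - 3) a)) -
    (3 * (15 * w ^ 4 + 96 * w ^ 3 + 151 * w ^ 2 - 30 * w - 116) : ℤ) * Qser * sd (w - 3) a -
    (6 * (w + 1) * (9 * w ^ 4 + 45 * w ^ 3 + 40 * w ^ 2 + 24 * w + 144) : ℤ) * Rser * a

/-- The first order system attached to a fourth order modular differential equation. -/
structure OdeSystem (w A B C : ℤ) (u₀ u₁ u₂ u₃ : PowerSeries ℂ) : Prop where
  eq₀ : 12 * qD u₀ = u₁ + ((w : PowerSeries ℂ) - 3) * Pser * u₀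
  eq₁ : 12 * qD u₁ = u₂ + ((w : PowerSeries ℂ) - 1) * Pser * u₁
  eq₂ : 12 * qD u₂ = u₃ + ((w : PowerSeries ℂ) + 1) * Pser * u₂
  eq₃ : 12 * qD u₃ = ((w : PowerSeries ℂ) + 3) * Pser * u₃ - A * Qser * u₂ -
    B * Rser * u₁ - C * Qser ^ 2 * u₀

namespace OdeSystem

variable {w A B C : ℤ} {u₀ u₁ u₂ u₃ : PowerSeries ℂ}

lemma sd_weight_six (h : OdeSystem w A B C u₀ u₁ u₂ u₃) (p r s : ℤ) :
    sd (w + 3) (p * u₃ + r * (Qser * u₁) + s * (Rser * u₀)) =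
    (r - p * A : ℤ) * (Qser * u₂) + (s - p * B - 4 * r : ℤ) * (Rser * u₁) +
      (-p * C - 6 * s : ℤ) * (Qser ^ 2 * u₀) := by
  simp only [sd, qD_add, qD_mul, qD_intCast]
  push_cast
  linear_combination p * h.eq₃ + r * u₁ * twelve_qD_Q + r * Qser * h.eq₁ +
    s * u₀ * twelve_qD_R + s * Rser * h.eq₀

lemma sd_weight_eight (h : OdeSystem w A B C u₀ u₁ u₂ u₃) (p r s : ℤ) :
    sd (w + 5) (p * (Qser * u₂) + r * (Rser * u₁) + s * (Qser ^ 2 * u₀)) =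
      p * (Qser * u₃) + (r - 4 * p : ℤ) * (Rser * u₂) + (s - 6 * r : ℤ) * (Qser ^ 2 * u₁) +
        (-8 * s : ℤ) * (Qser * Rser * u₀) := by
  simp only [sd, qD_add, qD_mul, qD_intCast, pow_two]
  push_cast
  linear_combination p * u₂ * twelve_qD_Q + p * Qser * h.eq₂ + r * u₁ * twelve_qD_R +
    r * Rser * h.eq₁ + 2 * s * Qser * u₀ * twelve_qD_Q + s * Qser ^ 2 * h.eq₀

lemma sd_weight_ten (h : OdeSystem w A B C u₀ u₁ u₂ u₃) (p r s t : ℤ) :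
    sd (w + 7) (p * (Qser * u₃) + r * (Rser * u₂) + s * (Qser ^ 2 * u₁) +
        t * (Qser * Rser * u₀)) =
      (r - 4 * p : ℤ) * (Rser * u₃) + (s - 6 * r - p * A : ℤ) * (Qser ^ 2 * u₂) +
        (t - 8 * s - p * B : ℤ) * (Qser * Rser * u₁) + (-4 * t : ℤ) * (Rser ^ 2 * u₀) +
        (-6 * t - p * C : ℤ) * (Qser ^ 3 * u₀) := by
  simp only [sd, qD_add, qD_mul, qD_intCast, pow_two]
  push_cast
  linear_combination p * u₃ * twelve_qD_Q + p * Qser * h.eq₃ + r * u₂ * twelve_qD_R +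
    r * Rser * h.eq₂ + 2 * s * Qser * u₁ * twelve_qD_Q + s * Qser ^ 2 * h.eq₁ +
    t * Rser * u₀ * twelve_qD_Q + t * Qser * u₀ * twelve_qD_R + t * Qser * Rser * h.eq₀

lemma sd_weight_twelve (h : OdeSystem w A B C u₀ u₁ u₂ u₃) (p r s t v : ℤ) :
    sd (w + 9) (p * (Rser * u₃) + r * (Qser ^ 2 * u₂) + s * (Qser * Rser * u₁) +
        t * (Rser ^ 2 * u₀) + v * (Qser ^ 3 * u₀)) =
      (r - 6 * p : ℤ) * (Qser ^ 2 * u₃) + (s - 8 * r - p * A : ℤ) * (Qser * Rser * u₂) +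
        (t - 4 * s - p * B : ℤ) * (Rser ^ 2 * u₁) + (v - 6 * s : ℤ) * (Qser ^ 3 * u₁) +
        (-12 * t - 12 * v - p * C : ℤ) * (Qser ^ 2 * Rser * u₀) := by
  simp only [sd, qD_add, qD_mul, qD_intCast, pow_succ, pow_zero, one_mul]
  push_cast
  linear_combination p * u₃ * twelve_qD_R + p * Rser * h.eq₃ + 2 * r * Qser * u₂ * twelve_qD_Q +
    r * Qser ^ 2 * h.eq₂ + s * Rser * u₁ * twelve_qD_Q + s * Qser * u₁ * twelve_qD_R +
    s * Qser * Rser * h.eq₁ + 2 * t * Rser * u₀ * twelve_qD_R + t * Rser ^ 2 * h.eq₀ +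
    3 * v * Qser ^ 2 * u₀ * twelve_qD_Q + v * Qser ^ 3 * h.eq₀

end OdeSystem

lemma odeSystem_of_odeLHS_eq_zero {w : ℤ} {a : PowerSeries ℂ} (h : odeLHS w a = 0) :
    OdeSystem w (10 - 6 * w ^ 2) (-8 * w ^ 3 + 24 * w ^ 2 - 40)
      (-3 * w ^ 4 + 24 * w ^ 3 - 54 * w ^ 2 + 81) a (sd (w - 3) a) (sd (w - 1) (sd (w - 3) a))
      (sd (w + 1) (sd (w - 1) (sd (w - 3) a))) := by
  have e (k : ℤ) (b : PowerSeries ℂ) : 12 * qD b = sd k b + k * Pser * b := by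
    rw [sd]
    ring
  refine ⟨(e (w - 3) _).trans (by push_cast; rfl), (e (w - 1) _).trans (by push_cast; rfl),
    (e (w + 1) _).trans (by push_cast; rfl), ?_⟩
  rw [e (w + 3)]
  rw [odeLHS] at h
  push_cast at h ⊢
  linear_combination h

/-- `K^up_w` maps solutions in weight `w` to solutions in weight `w + 6`. -/
lemma odeLHS_kup {w : ℤ} {a : PowerSeries ℂ} (h : odeLHS w a = 0) :
    odeLHS (w + 6) (kup w a) = 0 := by
  have hs := odeSystem_of_odeLHS_eq_zero h
  rw [kup]
  generalize sd (w + 1) (sd (w - 1) (sd (w - 3) a)) = u₃ at hs ⊢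
  generalize sd (w - 1) (sd (w - 3) a) = u₂ at hs
  generalize sd (w - 3) a = u₁ at hs ⊢
  have e (α β γ : ℤ) : (α : PowerSeries ℂ) * u₃ - β * Qser * u₁ - γ * Rser * a =
      α * u₃ + (-β : ℤ) * (Qser * u₁) + (-γ : ℤ) * (Rser * a) := by
    push_cast
    ring
  rw [odeLHS, e, show w + 6 - 3 = w + 3 by ring, show w + 6 - 1 = w + 5 by ring,
    show w + 6 + 1 = w + 7 by ring, show w + 6 + 3 = w + 9 by ring, hs.sd_weight_six,
    hs.sd_weight_eight, hs.sd_weight_ten, hs.sd_weight_twelve]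
  push_cast
  ring

section LeadingCoefficients

variable {m : ℕ} {b : PowerSeries ℂ}

/-- The second and third Fourier coefficients of a solution with exponent `m` in weight `3m`. -/
lemma coeffs_of_odeLHS_eq_zero (h0 : coeff 0 b = 1)
    (h : odeLHS (3 * m) (PowerSeries.X ^ m * b) = 0) :
    coeff 1 b = (3 * m ^ 4 + 18 * m ^ 3 + 9 * m ^ 2 - 6 * m) / (m + 1) ^ 3 ∧
    coeff 2 b = -((72 * m ^ 4 + 216 * m ^ 3 - 504 * m ^ 2 + 144 * m) +
      (-3 * m ^ 4 - 54 * m ^ 3 - 81 * m ^ 2 + 90 * m) * coeff 1 b) / (2 * (m + 2) ^ 3) := by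
  have e : PowerSeries.X ^ m *
      (sdX m (3 * m + 3) (sdX m (3 * m + 1) (sdX m (3 * m - 1) (sdX m (3 * m - 3) b))) +
        ((10 - 6 * (3 * m) ^ 2 : ℤ) : PowerSeries ℂ) *
          (Qser * sdX m (3 * m - 1) (sdX m (3 * m - 3) b)) +
        ((-8 * (3 * m) ^ 3 + 24 * (3 * m) ^ 2 - 40 : ℤ) : PowerSeries ℂ) *
          (Rser * sdX m (3 * m - 3) b) +
        ((-3 * (3 * m) ^ 4 + 24 * (3 * m) ^ 3 - 54 * (3 * m) ^ 2 + 81 : ℤ) : PowerSeries ℂ) *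
          (Qser * (Qser * b))) = 0 := by
    rw [← h, odeLHS]
    simp only [sd_X_pow_mul]
    ring
  have hs := (mul_eq_zero.mp e).resolve_left (pow_ne_zero _ (PowerSeries.X_ne_zero (R := ℂ)))
  have c1 := congrArg (coeff 1) hs
  have c2 := congrArg (coeff 2) hs
  simp only [map_add, coeff_intCast_mul, coeff_sdX, coeff_mul_zero, coeff_mul_one, coeff_mul_two,
    coeff_P_zero, coeff_P_one, coeff_P_two, coeff_Q_zero, coeff_Q_one, coeff_Q_two, coeff_R_zero,
    coeff_R_one, coeff_R_two, h0, map_zero] at c1 c2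
  push_cast at c1 c2
  have n1 : (m + 1 : ℂ) ≠ 0 := by exact_mod_cast m.succ_ne_zero
  have n2 : (m + 2 : ℂ) ≠ 0 := by exact_mod_cast (m + 1).succ_ne_zero
  constructor
  · rw [eq_div_iff (pow_ne_zero _ n1)]
    linear_combination c1 / 20736
  · rw [eq_div_iff (mul_ne_zero two_ne_zero (pow_ne_zero _ n2))]
    linear_combination c2 / 20736

/-- The operator `kup` conjugated by multiplication with `X ^ m`. -/
lemma exists_kup_X_pow_mul (h0 : coeff 0 b = 1)
    (h : odeLHS (3 * m) (PowerSeries.X ^ m * b) = 0) :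
    ∃ s : PowerSeries ℂ, kup (3 * m) (PowerSeries.X ^ m * b) = PowerSeries.X ^ m * s ∧
      coeff 0 s = 0 ∧ coeff 1 s = 0 ∧
      coeff 2 s = 36 * (2 ^ 2 * 3 ^ 7 * (3 * m + 1) * (3 * m + 2) ^ 3 * (3 * m + 4) ^ 3 *
        (3 * m + 5)) / (3 * m + 6) ^ 3 := by
  obtain ⟨h1, h2⟩ := coeffs_of_odeLHS_eq_zero h0 h
  refine ⟨((7 * (3 * m) ^ 2 + 42 * (3 * m) + 60 : ℤ) : PowerSeries ℂ) *
      sdX m (3 * m + 1) (sdX m (3 * m - 1) (sdX m (3 * m - 3) b)) -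
    ((3 * (15 * (3 * m) ^ 4 + 96 * (3 * m) ^ 3 + 151 * (3 * m) ^ 2 - 30 * (3 * m) - 116) : ℤ) :
      PowerSeries ℂ) * (Qser * sdX m (3 * m - 3) b) -
    ((6 * (3 * m + 1) * (9 * (3 * m) ^ 4 + 45 * (3 * m) ^ 3 + 40 * (3 * m) ^ 2 + 24 * (3 * m) +
      144) : ℤ) : PowerSeries ℂ) * (Rser * b), ?_, ?_, ?_, ?_⟩
  · rw [kup]
    simp only [sd_X_pow_mul]
    ring
  all_goals
    simp only [map_sub, coeff_intCast_mul, coeff_sdX, coeff_mul_zero, coeff_mul_one,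
      coeff_mul_two, coeff_P_zero, coeff_P_one, coeff_P_two, coeff_Q_zero, coeff_Q_one,
      coeff_Q_two, coeff_R_zero, coeff_R_one, coeff_R_two, h0]
    push_cast
  · ring
  · rw [h1]
    have n1 : (m + 1 : ℂ) ≠ 0 := by exact_mod_cast m.succ_ne_zero
    field_simp
    ring
  · rw [h2, h1]
    have n1 : (m + 1 : ℂ) ≠ 0 := by exact_mod_cast m.succ_ne_zero
    have n2 : (m + 2 : ℂ) ≠ 0 := by exact_mod_cast (m + 1).succ_ne_zero
    rw [show (3 * m + 6 : ℂ) = 3 * (m + 2) by ring]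
    field_simp
    ring

lemma exists_four_X_pow_mul (h0 : coeff 0 b = 1)
    (h : odeLHS (3 * m) (PowerSeries.X ^ m * b) = 0) :
    ∃ s : PowerSeries ℂ, ((3 * (3 * m + 1) * (3 * (3 * m) + 1) : ℤ) : PowerSeries ℂ) *
        (Qser * (PowerSeries.X ^ m * b)) -
        sd (3 * m - 1) (sd (3 * m - 3) (PowerSeries.X ^ m * b)) = PowerSeries.X ^ m * s ∧
      coeff 0 s = 0 ∧
      coeff 1 s = 144 * (27 * (3 * m + 1) * (3 * m + 2) ^ 3) / (2 * (3 * m + 3) ^ 2) := by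
  obtain ⟨h1, -⟩ := coeffs_of_odeLHS_eq_zero h0 h
  refine ⟨((3 * (3 * m + 1) * (3 * (3 * m) + 1) : ℤ) : PowerSeries ℂ) * (Qser * b) -
    sdX m (3 * m - 1) (sdX m (3 * m - 3) b), ?_, ?_, ?_⟩
  · simp only [sd_X_pow_mul]
    ring
  all_goals
    simp only [map_sub, coeff_intCast_mul, coeff_sdX, coeff_mul_zero, coeff_mul_one,
      coeff_P_zero, coeff_P_one, coeff_Q_zero, coeff_Q_one, h0]
    push_cast
  · ring
  · rw [h1]
    have n1 : (m + 1 : ℂ) ≠ 0 := by exact_mod_cast m.succ_ne_zero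
    rw [show (3 * m + 3 : ℂ) = 3 * (m + 1) by ring]
    field_simp
    ring

end LeadingCoefficients

/-- `51840` times the extremal form of weight `6`. -/
noncomputable def sixSer : PowerSeries ℂ := 5 * Pser ^ 3 - 3 * Pser * Qser - 2 * Rser

lemma sixSer_mem : sixSer ∈ QMser 6 :=
  mem_QMser_iff_exists.mpr ⟨(-2 : ℤ) * Rser, Mser.intCast_mul _ Mser.R, (-3 : ℤ) * Qser,
    Mser.intCast_mul _ Mser.Q, 0, Mser.zero, (5 : ℤ) * 1, Mser.intCast_mul _ Mser.one, by
      rw [sixSer]; push_cast; ring⟩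

lemma odeLHS_sixSer : odeLHS 6 sixSer = 0 := by
  have e1 : sd 3 sixSer = -21 * Pser ^ 2 * Qser + 15 * Qser ^ 2 + 6 * Pser * Rser := by
    simp only [sd, sixSer, qD_sub, qD_mul, qD_ofNat, pow_succ, pow_zero, one_mul]
    push_cast
    linear_combination (15 * Pser ^ 2 - 3 * Qser) * twelve_qD_P - 3 * Pser * twelve_qD_Q -
      2 * twelve_qD_R
  have e2 : sd 5 (sd 3 sixSer) =
      -21 * Pser ^ 3 * Qser + 51 * Pser * Qser ^ 2 + 96 * Pser ^ 2 * Rser - 126 * Qser * Rser := by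
    rw [e1]
    simp only [sd, qD_add, qD_mul, qD_ofNat, qD_neg, pow_succ, pow_zero, one_mul]
    push_cast
    linear_combination (-42 * Pser * Qser + 6 * Rser) * twelve_qD_P +
      (-21 * Pser ^ 2 + 30 * Qser) * twelve_qD_Q + 6 * Pser * twelve_qD_R
  have e3 : sd 7 (sd 5 (sd 3 sixSer)) = -411 * Pser ^ 2 * Qser ^ 2 + 180 * Pser ^ 3 * Rser +
      705 * Qser ^ 3 - 978 * Pser * Qser * Rser + 504 * Rser ^ 2 := by
    rw [e2]
    simp only [sd, qD_add, qD_sub, qD_mul, qD_ofNat, qD_neg, pow_succ, pow_zero, one_mul]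
    push_cast
    linear_combination
      (-63 * Pser ^ 2 * Qser + 51 * Qser ^ 2 + 192 * Pser * Rser) * twelve_qD_P +
      (-21 * Pser ^ 3 + 102 * Pser * Qser - 126 * Rser) * twelve_qD_Q +
      (96 * Pser ^ 2 - 126 * Qser) * twelve_qD_R
  have e4 : sd 9 (sd 7 (sd 5 (sd 3 sixSer))) = -1491 * Pser ^ 3 * Qser ^ 2 +
      8805 * Pser * Qser ^ 3 + 792 * Pser ^ 2 * Qser * Rser - 13530 * Qser ^ 2 * Rser +
      5424 * Pser * Rser ^ 2 := by
    rw [e3]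
    simp only [sd, qD_add, qD_sub, qD_mul, qD_ofNat, qD_neg, pow_succ, pow_zero, one_mul]
    push_cast
    linear_combination
      (-822 * Pser * Qser ^ 2 + 540 * Pser ^ 2 * Rser - 978 * Qser * Rser) * twelve_qD_P +
      (-822 * Pser ^ 2 * Qser + 2115 * Qser ^ 2 - 978 * Pser * Rser) * twelve_qD_Q +
      (180 * Pser ^ 3 - 978 * Pser * Qser + 1008 * Rser) * twelve_qD_R
  rw [odeLHS, show (6 - 3 : ℤ) = 3 by norm_num, show (6 - 1 : ℤ) = 5 by norm_num,
    show (6 + 1 : ℤ) = 7 by norm_num, show (6 + 3 : ℤ) = 9 by norm_num, e4, e2, e1, sixSer]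
  push_cast
  ring

/-- The family of power series `q^{-⌊w/3⌋} f_w` of normalized extremal forms. -/
def IsExtremalFamily (b : ℕ → PowerSeries ℂ) : Prop :=
  ∀ w : ℕ, Even w → 6 ≤ w → PowerSeries.X ^ (w / 3) * b w ∈ QMser w ∧ coeff 0 (b w) = 1

lemma QMser.intCast_mul {w : ℤ} {a : PowerSeries ℂ} (n : ℤ) (ha : a ∈ QMser w) :
    n * a ∈ QMser w := by
  rw [← zsmul_eq_mul]
  exact zsmul_mem ha n

lemma QMser.kup {w : ℤ} {a : PowerSeries ℂ} (ha : a ∈ QMser w) : kup w a ∈ QMser (w + 6) := by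
  have h1 := QMser.sd ha
  have h2 := QMser.sd h1
  have h3 := QMser.sd h2
  rw [show w + 2 - 3 = w - 1 by ring] at h2 h3
  rw [show w + 2 + 2 - 3 = w + 1 by ring, show w + 2 + 2 + 2 = w + 6 by ring] at h3
  have hQ := QMser.mul Mser.Q h1
  rw [show w + 2 + 4 = w + 6 by ring] at hQ
  rw [_root_.kup, mul_assoc, mul_assoc]
  exact sub_mem (sub_mem (QMser.intCast_mul _ h3) (QMser.intCast_mul _ hQ))
    (QMser.intCast_mul _ (QMser.mul Mser.R ha))

namespace IsExtremalFamily

variable {b : ℕ → PowerSeries ℂ}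

lemma hasOrder (hb : IsExtremalFamily b) (w : ℕ) (hw : Even w) (h6 : 6 ≤ w) :
    HasOrder w (w / 3) :=
  ⟨b w, (hb w hw h6).1, by rw [(hb w hw h6).2]; exact one_ne_zero⟩

/-- An element of `QM_w^3` vanishing to the extremal order is a multiple of the extremal form. -/
lemma eq_smul (hb : IsExtremalFamily b) {w m d : ℕ} (hw : Even w) (h6 : 6 ≤ w)
    (hd : w / 3 = m + d) {s : PowerSeries ℂ} (hs : PowerSeries.X ^ m * s ∈ QMser w)
    (hz : ∀ i < d, coeff i s = 0) :
    PowerSeries.X ^ m * s = coeff d s • (PowerSeries.X ^ (w / 3) * b w) := by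
  refine sub_eq_zero.mp (QMser.eq_zero hb.hasOrder hw h6
    (sub_mem hs ((QMser w).smul_mem _ (hb w hw h6).1)) fun i hi => ?_)
  rw [map_sub, PowerSeries.coeff_smul, PowerSeries.coeff_X_pow_mul', PowerSeries.coeff_X_pow_mul']
  rcases lt_or_eq_of_le hi with h | rfl
  · rw [if_neg (by omega : ¬ w / 3 ≤ i), smul_zero, sub_zero]
    split_ifs with h'
    · exact hz _ (by omega)
    · rfl
  · rw [if_pos le_rfl, if_pos (by omega), Nat.sub_self, (hb w hw h6).2, hd,
      Nat.add_sub_cancel_left, smul_eq_mul, mul_one, sub_self]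

lemma six (hb : IsExtremalFamily b) :
    sixSer = (51840 : ℂ) • (PowerSeries.X ^ (6 / 3) * b 6) := by
  have hc (n : ℕ) : coeff n sixSer = 5 * coeff n (Pser * (Pser * Pser)) -
      3 * coeff n (Pser * Qser) - 2 * coeff n Rser := by
    rw [← Int.cast_ofNat (R := ℂ) 5, ← Int.cast_ofNat (R := ℂ) 3, ← Int.cast_ofNat (R := ℂ) 2,
      ← coeff_intCast_mul, ← coeff_intCast_mul, ← coeff_intCast_mul, ← map_sub, ← map_sub, sixSer]
    push_cast
    ring_nf
  have h := hb.eq_smul (w := 6) (m := 0) (d := 2) (by decide) le_rfl rfl (s := sixSer)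
    (by rw [pow_zero, one_mul]; exact sixSer_mem) fun i hi => by
      interval_cases i <;>
      · simp only [hc, coeff_mul_zero, coeff_mul_one, coeff_P_zero, coeff_P_one, coeff_Q_zero,
          coeff_Q_one, coeff_R_zero, coeff_R_one]
        norm_num
  have h2 : coeff 2 sixSer = 51840 := by
    simp only [hc, coeff_mul_zero, coeff_mul_one, coeff_mul_two, coeff_P_zero, coeff_P_one,
      coeff_P_two, coeff_Q_zero, coeff_Q_one, coeff_Q_two, coeff_R_two]
    norm_num
  rwa [h2, pow_zero, one_mul] at h

end IsExtremalFamily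

namespace IsExtremalFamily

variable {b : ℕ → PowerSeries ℂ}

lemma kup_eq (hb : IsExtremalFamily b) {m : ℕ} (hm : Even m) (h2 : 2 ≤ m)
    (h : odeLHS (3 * m) (PowerSeries.X ^ m * b (3 * m)) = 0) :
    kup (3 * m) (PowerSeries.X ^ m * b (3 * m)) =
      (36 * (2 ^ 2 * 3 ^ 7 * (3 * m + 1) * (3 * m + 2) ^ 3 * (3 * m + 4) ^ 3 *
        (3 * m + 5)) / (3 * m + 6) ^ 3 : ℂ) • (PowerSeries.X ^ (m + 2) * b (3 * (m + 2))) := by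
  have hF := hb (3 * m) (hm.mul_left 3) (by omega)
  rw [Nat.mul_div_cancel_left m three_pos] at hF
  obtain ⟨s, hs, s0, s1, s2⟩ := exists_kup_X_pow_mul hF.2 h
  have hk := QMser.kup hF.1
  push_cast at hk
  rw [hs, show (3 * m + 6 : ℤ) = (3 * (m + 2) : ℕ) by push_cast; ring] at hk
  have := hb.eq_smul (d := 2) ((hm.add even_two).mul_left 3) (by omega)
    (Nat.mul_div_cancel_left _ three_pos) hk fun i hi => by interval_cases i <;> assumption
  rwa [s2, Nat.mul_div_cancel_left _ three_pos, ← hs] at this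

lemma odeLHS_eq_zero (hb : IsExtremalFamily b) (n : ℕ) :
    odeLHS (3 * (2 * n + 2 : ℕ)) (PowerSeries.X ^ (2 * n + 2) * b (3 * (2 * n + 2))) = 0 := by
  induction n with
  | zero =>
    have h := odeLHS_sixSer
    rw [hb.six, odeLHS_smul] at h
    exact (smul_eq_zero.mp h).resolve_left (by norm_num)
  | succ n ih =>
    have h := odeLHS_kup ih
    rw [hb.kup_eq ((even_two_mul n).add even_two) (by omega) ih, odeLHS_smul] at h
    refine (smul_eq_zero.mp h).resolve_left (div_ne_zero ?_ ?_) <;>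
    · norm_cast
      positivity

lemma sd_eq (hb : IsExtremalFamily b) {m : ℕ} (hm : Even m) (h2 : 2 ≤ m) :
    sd (3 * m - 3) (PowerSeries.X ^ m * b (3 * m)) =
      (3 * (3 * m + 1) : ℂ) • (PowerSeries.X ^ m * b (3 * m + 2)) := by
  have hF := hb (3 * m) (hm.mul_left 3) (by omega)
  rw [Nat.mul_div_cancel_left m three_pos] at hF
  have hk := QMser.sd hF.1
  push_cast at hk
  rw [sd_X_pow_mul, show (3 * m + 2 : ℤ) = (3 * m + 2 : ℕ) by push_cast; ring] at hk
  have hd : (3 * m + 2) / 3 = m := by omega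
  have := hb.eq_smul (d := 0) ((hm.mul_left 3).add even_two) (by omega) hd hk (by simp)
  rw [hd, ← sd_X_pow_mul] at this
  rw [this, coeff_sdX, coeff_mul_zero, hF.2, coeff_P_zero]
  congr 1
  push_cast
  ring

lemma four_eq (hb : IsExtremalFamily b) {m : ℕ} (hm : Even m) (h2 : 2 ≤ m)
    (h : odeLHS (3 * m) (PowerSeries.X ^ m * b (3 * m)) = 0) :
    ((3 * (3 * m + 1) * (3 * (3 * m) + 1) : ℤ) : PowerSeries ℂ) *
        (Qser * (PowerSeries.X ^ m * b (3 * m))) -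
        sd (3 * m - 1) (sd (3 * m - 3) (PowerSeries.X ^ m * b (3 * m))) =
      (144 * (27 * (3 * m + 1) * (3 * m + 2) ^ 3) / (2 * (3 * m + 3) ^ 2) : ℂ) •
        (PowerSeries.X ^ (m + 1) * b (3 * m + 4)) := by
  have hF := hb (3 * m) (hm.mul_left 3) (by omega)
  rw [Nat.mul_div_cancel_left m three_pos] at hF
  obtain ⟨s, hs, s0, s1⟩ := exists_four_X_pow_mul hF.2 h
  have hQ := QMser.mul Mser.Q hF.1
  have hk := QMser.sd (QMser.sd hF.1)
  push_cast at hk hQ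
  rw [show (3 * m + 2 - 3 : ℤ) = 3 * m - 1 by ring, add_assoc] at hk
  have hk := sub_mem (QMser.intCast_mul (3 * (3 * m + 1) * (3 * (3 * m) + 1)) hQ) hk
  rw [hs, show (3 * m + 4 : ℤ) = (3 * m + 4 : ℕ) by push_cast; ring] at hk
  have hd : (3 * m + 4) / 3 = m + 1 := by omega
  have := hb.eq_smul (d := 1) ((hm.mul_left 3).add (by decide)) (by omega) hd hk
    fun i hi => by interval_cases i; assumption
  rwa [s1, hd, ← hs] at this

end IsExtremalFamily

lemma HasQ.serre_smul {f : ℍ → ℂ} {a : PowerSeries ℂ} (h : HasQ f a) (k : ℤ) :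
    HasQ (_root_.serre k f) ((1 / 12 : ℂ) • sd k a) := by
  have := (h.serre k).smul (1 / 12)
  rwa [smul_smul, one_div_mul_cancel (by norm_num), one_smul] at this

lemma HasQ.serreIter_two {f : ℍ → ℂ} {a : PowerSeries ℂ} (h : HasQ f a) (w : ℤ) :
    HasQ ((144 : ℂ) • serreIter (w - 3) 2 f) (sd (w - 1) (sd (w - 3) a)) := by
  have := ((h.serre_smul (w - 3)).serre_smul (w - 1)).smul 144
  rw [sd_smul, smul_smul, smul_smul, show (144 * (1 / 12) * (1 / 12) : ℂ) = 1 by norm_num,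
    one_smul] at this
  simpa [serreIter, show w - 3 + 2 = w - 1 by ring] using this

lemma HasQ.serreIter_three {f : ℍ → ℂ} {a : PowerSeries ℂ} (h : HasQ f a) (w : ℤ) :
    HasQ ((1728 : ℂ) • serreIter (w - 3) 3 f) (sd (w + 1) (sd (w - 1) (sd (w - 3) a))) := by
  have := (((h.serreIter_two w).smul (1 / 144)).serre_smul (w + 1)).smul 1728
  rw [sd_smul, smul_smul, smul_smul, smul_smul, one_div_mul_cancel (by norm_num), one_smul,
    show (1728 * (1 / 12) * (1 / 144) : ℂ) = 1 by norm_num, one_smul] at this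
  rwa [serreIter, show w - 3 + 2 * (2 : ℕ) = w + 1 by push_cast; ring]

lemma HasQ.kup {f : ℍ → ℂ} {a : PowerSeries ℂ} (h : HasQ f a) (w : ℤ) :
    HasQ (((7 * w ^ 2 + 42 * w + 60 : ℤ) : ℂ) • (1728 : ℂ) • serreIter (w - 3) 3 f -
      ((3 * (15 * w ^ 4 + 96 * w ^ 3 + 151 * w ^ 2 - 30 * w - 116) : ℤ) : ℂ) •
        (Eis 4 * (12 : ℂ) • _root_.serre (w - 3) f) -
      ((6 * (w + 1) * (9 * w ^ 4 + 45 * w ^ 3 + 40 * w ^ 2 + 24 * w + 144) : ℤ) : ℂ) •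
        (Eis 6 * f)) (kup w a) := by
  rw [_root_.kup, mul_assoc _ Qser, mul_assoc _ Rser]
  exact (((h.serreIter_three w).intCast_mul _).sub
    ((hasQ_Eis_four.mul (h.serre _)).intCast_mul _)).sub ((hasQ_Eis_six.mul h).intCast_mul _)

lemma hasQ_sixSer : HasQ (fun z => 5 * Eis 2 z ^ 3 - 3 * Eis 2 z * Eis 4 z - 2 * Eis 6 z)
    sixSer := by
  have := (((hasQ_Eis_two.pow 3).intCast_mul 5).sub
    ((hasQ_Eis_two.mul hasQ_Eis_four).intCast_mul 3)).sub (hasQ_Eis_six.intCast_mul 2)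
  push_cast at this
  rw [sixSer, mul_assoc]
  convert this using 1
  ext z
  simp [mul_assoc]

/-- Proposition 9 of the paper: recursions for the normalized extremal
quasimodular forms of depth `3`, where
`K^up_w f = 48(7w²+42w+60)∂_{w-3}³f − (15w⁴+96w³+151w²−30w−116)E_4∂_{w-3}f
− (1/6)(w+1)(9w⁴+45w³+40w²+24w+144)E_6 f`. -/
theorem depth_three_recursions (f : ℤ → ℍ → ℂ)
    (hf : ∀ w : ℤ, Even w → 6 ≤ w → IsNormalizedExtremalQM w 3 (f w))
    (Kup : ℤ → (ℍ → ℂ) → (ℍ → ℂ))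
    (hKup : ∀ (w : ℤ) (g : ℍ → ℂ) (z : ℍ),
      Kup w g z =
        48 * (7 * (w : ℂ) ^ 2 + 42 * (w : ℂ) + 60) * serreIter (w - 3) 3 g z -
          (15 * (w : ℂ) ^ 4 + 96 * (w : ℂ) ^ 3 + 151 * (w : ℂ) ^ 2 - 30 * (w : ℂ) - 116) *
            Eis 4 z * serre (w - 3) g z -
          (1 / 6 : ℂ) * ((w : ℂ) + 1) *
            (9 * (w : ℂ) ^ 4 + 45 * (w : ℂ) ^ 3 + 40 * (w : ℂ) ^ 2 + 24 * (w : ℂ) + 144) *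
            Eis 6 z * g z) :
    (∀ z : ℍ, f 6 z = (5 * Eis 2 z ^ 3 - 3 * Eis 2 z * Eis 4 z - 2 * Eis 6 z) / 51840) ∧
    ∀ w : ℤ, 6 ≤ w → w % 6 = 0 →
      ((∀ z : ℍ, f (w + 6) z =
          ((w : ℂ) + 6) ^ 3 /
              (2 ^ 2 * 3 ^ 7 * ((w : ℂ) + 1) * ((w : ℂ) + 2) ^ 3 * ((w : ℂ) + 4) ^ 3 *
                ((w : ℂ) + 5)) * Kup w (f w) z) ∧
       (∀ z : ℍ, f (w + 2) z = 4 / ((w : ℂ) + 1) * serre (w - 3) (f w) z) ∧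
       (∀ z : ℍ, f (w + 4) z =
          2 * ((w : ℂ) + 3) ^ 2 / (27 * ((w : ℂ) + 1) * ((w : ℂ) + 2) ^ 3) *
            (((w : ℂ) + 1) * (3 * (w : ℂ) + 1) / 48 * Eis 4 z * f w z -
              serreIter (w - 3) 2 (f w) z))) := by
  have hex (w : ℕ) : ∃ b : PowerSeries ℂ, Even w → 6 ≤ w →
      HasQ (f w) (PowerSeries.X ^ (w / 3) * b) ∧ PowerSeries.X ^ (w / 3) * b ∈ QMser w ∧
        coeff 0 b = 1 := by
    by_cases h : Even w ∧ 6 ≤ w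
    · obtain ⟨b, hb⟩ := (hf w (by exact_mod_cast h.1) (by exact_mod_cast h.2)).exists_series h.1 h.2
      exact ⟨b, fun _ _ => hb⟩
    · exact ⟨0, fun h1 h2 => absurd ⟨h1, h2⟩ h⟩
  choose b hb using hex
  have hB : IsExtremalFamily b := fun w hw h6 => (hb w hw h6).2
  have hq {w m : ℕ} (hw : Even w) (h6 : 6 ≤ w) (hm : w / 3 = m) :
      HasQ (f w) (PowerSeries.X ^ m * b w) := hm ▸ (hb w hw h6).1
  constructor
  · intro z
    have h := (hq (w := 6) (by decide) le_rfl rfl).smul 51840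
    rw [← hB.six] at h
    have h' := congrFun (h.eq_fun hasQ_sixSer) z
    simp only [Pi.smul_apply, smul_eq_mul, Nat.cast_ofNat] at h'
    rw [eq_div_iff (by norm_num), mul_comm, h']
  intro w hw h6
  obtain ⟨n, rfl⟩ : ∃ n : ℕ, w = 3 * (2 * n + 2 : ℕ) := ⟨(w / 6 - 1).toNat, by omega⟩
  have hode := hB.odeLHS_eq_zero n
  have hm : Even (2 * n + 2) := (even_two_mul n).add even_two
  have h2 : 2 ≤ 2 * n + 2 := by omega
  have hne (j : ℕ) (hj : j ≠ 0) : (3 * (2 * n + 2 : ℕ) + j : ℂ) ≠ 0 := by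
    norm_cast
    omega
  generalize 2 * n + 2 = m at hode hm h2 hne
  have n1 := hne 1 one_ne_zero
  have n2 := hne 2 two_ne_zero
  have n3 := hne 3 three_ne_zero
  have n4 := hne 4 four_ne_zero
  have n5 := hne 5 (by decide)
  have n6 := hne 6 (by decide)
  push_cast at n1 n2 n3 n4 n5 n6
  have hF : HasQ (f (3 * m)) (PowerSeries.X ^ m * b (3 * m)) := by
    exact_mod_cast hq (hm.mul_left 3) (by omega) (Nat.mul_div_cancel_left m three_pos)
  push_cast
  refine ⟨fun z => ?_, fun z => ?_, fun z => ?_⟩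
  · have h := (hq (w := 3 * (m + 2)) ((hm.add even_two).mul_left 3) (by omega)
      (Nat.mul_div_cancel_left _ three_pos)).smul (36 * (2 ^ 2 * 3 ^ 7 * (3 * m + 1) *
        (3 * m + 2) ^ 3 * (3 * m + 4) ^ 3 * (3 * m + 5)) / (3 * m + 6) ^ 3 : ℂ)
    rw [← hB.kup_eq hm h2 hode] at h
    have h' := congrFun (h.eq_fun (hF.kup (3 * m))) z
    rw [hKup]
    simp only [Pi.smul_apply, Pi.sub_apply, Pi.mul_apply, smul_eq_mul] at h'
    push_cast at h'
    rw [show (3 * ((m : ℤ) + 2)) = 3 * m + 6 by ring] at h'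
    push_cast
    field_simp at h' ⊢
    linear_combination h' / 6
  · have h := (hq (w := 3 * m + 2) ((hm.mul_left 3).add even_two) (by omega)
      (by omega : _ = m)).smul (3 * (3 * m + 1) : ℂ)
    rw [← hB.sd_eq hm h2] at h
    have h' := congrFun (h.eq_fun (hF.serre (3 * m - 3))) z
    simp only [Pi.smul_apply, smul_eq_mul] at h'
    push_cast at h'
    field_simp
    linear_combination h' / 3
  · have h := (hq (w := 3 * m + 4) ((hm.mul_left 3).add (by decide)) (by omega)
      (by omega : _ = m + 1)).smul
        (144 * (27 * (3 * m + 1) * (3 * m + 2) ^ 3) / (2 * (3 * m + 3) ^ 2) : ℂ)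
    rw [← hB.four_eq hm h2 hode] at h
    have h' := congrFun (h.eq_fun (((hasQ_Eis_four.mul hF).intCast_mul _).sub
      (hF.serreIter_two (3 * m)))) z
    simp only [Pi.smul_apply, Pi.sub_apply, Pi.mul_apply, smul_eq_mul] at h'
    push_cast at h'
    field_simp at h' ⊢
    linear_combination h' / 3
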